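/- arXiv:2110.07779 — 3 statements merged into one kernel-verified Lean document; each statement's English description precedes it below -/
import Mathlib

section
/- Let n ≥ m ≥ 2 and p ≥ 1 be integers with n ≥ p + 3, and set c = 2p+1. Consider a 2-coloring of the edges of the complete graph on a vertex set V with |V| = 2(n+m+p) − 1, and suppose u ∈ V satisfies red-d(u) ≥ red-d(v) and red-d(u) ≥ blue-d(v) for all v ∈ V, and red-d(u) ≥ n + m + 3p. Then the coloring contains a monochromatic copy of S_c(n,m). -/
open SimpleGraph

/-- The relation generating the edges of the linked double star `S_c(n,m)`:
vertices are `a_1, …, a_c` (the link, modelled by `Fin c`), the spokes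
`v_1, …, v_n` of the `n`-star at `a_1` (modelled by `Fin n`), and the spokes
`w_1, …, w_m` of the `m`-star at `a_c` (modelled by `Fin m`). -/
def ldsRel (c n m : ℕ) : (Fin c ⊕ Fin n ⊕ Fin m) → (Fin c ⊕ Fin n ⊕ Fin m) → Prop
  | Sum.inl i, Sum.inl j => (j : ℕ) = (i : ℕ) + 1
  | Sum.inl i, Sum.inr (Sum.inl _) => (i : ℕ) = 0
  | Sum.inl i, Sum.inr (Sum.inr _) => (i : ℕ) = c - 1
  | _, _ => False

/-- The linked double star `S_c(n,m)`. -/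
def LinkedDoubleStar (c n m : ℕ) : SimpleGraph (Fin c ⊕ Fin n ⊕ Fin m) :=
  SimpleGraph.fromRel (ldsRel c n m)

/-- `G` contains a (not necessarily induced) subgraph isomorphic to `H`. -/
def HasCopy {α β : Type*} (H : SimpleGraph α) (G : SimpleGraph β) : Prop :=
  ∃ f : α → β, Function.Injective f ∧ ∀ ⦃a b⦄, H.Adj a b → G.Adj (f a) (f b)

/-- A 2-coloring of the complete graph on `β` is encoded by the graph `G` of red
edges (so `Gᶜ` is the graph of blue edges).  `HasMonoLDS G c n m` says this
coloring contains a monochromatic copy of `S_c(n,m)`. -/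
def HasMonoLDS {β : Type*} (G : SimpleGraph β) (c n m : ℕ) : Prop :=
  HasCopy (LinkedDoubleStar c n m) G ∨ HasCopy (LinkedDoubleStar c n m) Gᶜ

/-- Every 2-coloring of the edges of `K_r` contains a monochromatic `S_c(n,m)`. -/
def IsRamseyLDS (c n m r : ℕ) : Prop :=
  ∀ G : SimpleGraph (Fin r), HasMonoLDS G c n m

/-- The Ramsey number of the linked double star `S_c(n,m)`: the least positive
`r` such that every 2-coloring of the edges of `K_r` contains a monochromatic
copy of `S_c(n,m)`. -/
noncomputable def ramseyLDS (c n m : ℕ) : ℕ :=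
  sInf {r | 0 < r ∧ IsRamseyLDS c n m r}

/-- `f` exhibits a cycle on `L` vertices in `G` (the vertices `f 0, f 1, …`
arranged cyclically, consecutive ones adjacent in `G`). -/
def IsCycleMap {β : Type*} {L : ℕ} (G : SimpleGraph β) (f : ZMod L → β) : Prop :=
  Function.Injective f ∧ ∀ i : ZMod L, G.Adj (f i) (f (i + 1))

/-- For a monochromatic cycle with vertex set `C`, all of whose edges have the
color given by the graph `H`, `cycStat H C` is the maximum over vertices
`z ∉ C` of the number of `H`-edges from `z` into `C` (denoted `s(C)`). -/
noncomputable def cycStat {β : Type*} (H : SimpleGraph β) (C : Set β) : ℕ :=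
  sSup ((fun z => ({w ∈ C | H.Adj z w}).ncard) '' Cᶜ)

/-- `Q` is the vertex set of a path of `G` starting at `x`. -/
def RPath {V : Type*} (G : SimpleGraph V) (Q : Finset V) (x : V) : Prop :=
  ∃ l : List V, l.Nodup ∧ l.IsChain G.Adj ∧ l.head? = some x ∧ ∀ v, v ∈ l ↔ v ∈ Q

theorem copy_of_list {V : Type*} [Fintype V] [DecidableEq V] (H : SimpleGraph V)
    (c n m : ℕ) (hc : 1 ≤ c) (l : List V) (hl : l.length = c) (hnd : l.Nodup)
    (hch : l.IsChain H.Adj) (x y : V) (hx : l.head? = some x) (hy : l.getLast? = some y)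
    (A B : Finset V) (hA : A.card = n) (hB : B.card = m) (hAB : Disjoint A B)
    (hAl : ∀ v ∈ A, v ∉ l ∧ H.Adj x v) (hBl : ∀ v ∈ B, v ∉ l ∧ H.Adj y v) :
    HasCopy (LinkedDoubleStar c n m) H := by
  subst hl
  let eA := A.equivFinOfCardEq hA
  let eB := B.equivFinOfCardEq hB
  have h0 : l[0] = x := by
    rw [List.head?_eq_getElem?] at hx
    exact (List.getElem?_eq_some_iff.1 hx).2
  have h1 : l[l.length - 1] = y := by
    rw [List.getLast?_eq_getElem?] at hy
    exact (List.getElem?_eq_some_iff.1 hy).2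
  let f : Fin l.length ⊕ Fin n ⊕ Fin m → V := fun
    | Sum.inl i => l[i]
    | Sum.inr (Sum.inl i) => eA.symm i
    | Sum.inr (Sum.inr i) => eB.symm i
  have key : ∀ a b, ldsRel l.length n m a b → H.Adj (f a) (f b) := by
    rintro (i | i | i) (j | j | j) h <;> simp only [ldsRel] at h
    · have := List.isChain_iff_getElem.1 hch i (by omega)
      simp only [f]
      simp only [← h] at this
      exact this
    · have := (hAl _ (eA.symm j).2).2
      simp only [f]
      have hh : l[i] = x := by rw [← h0]; simp [h]
      rw [hh]; exact this
    · have := (hBl _ (eB.symm j).2).2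
      simp only [f]
      have hh : l[i] = y := by rw [← h1]; simp [h]
      rw [hh]; exact this
  refine ⟨f, ?_, ?_⟩
  · rintro (i | i | i) (j | j | j) h <;> simp only [f] at h
    · have := (List.Nodup.getElem_inj_iff hnd).1 h
      congr 1; exact Fin.ext this
    · exact absurd (h ▸ List.getElem_mem _) (hAl _ (eA.symm j).2).1
    · exact absurd (h ▸ List.getElem_mem _) (hBl _ (eB.symm j).2).1
    · exact absurd (h ▸ List.getElem_mem _) (hAl _ (eA.symm i).2).1
    · have := eA.symm.injective (Subtype.ext h); rw [this]
    · exact absurd h (Finset.disjoint_left.1 hAB (eA.symm i).2 |> fun q e => q (e ▸ (eB.symm j).2))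
    · exact absurd (h ▸ List.getElem_mem _) (hBl _ (eB.symm i).2).1
    · exact absurd h (Finset.disjoint_left.1 hAB (eA.symm j).2 |> fun q e => q (e ▸ (eB.symm i).2))
    · have := eB.symm.injective (Subtype.ext h); rw [this]
  · intro a b hab
    rw [LinkedDoubleStar, SimpleGraph.fromRel_adj] at hab
    rcases hab.2 with h | h
    · exact key _ _ h
    · exact (key _ _ h).symm

theorem copy_of_path {V : Type*} [Fintype V] [DecidableEq V] (H : SimpleGraph V)
    [DecidableRel H.Adj]
    (p n m : ℕ) (l : List V) (hl : l.length = 2 * p + 1) (hnd : l.Nodup)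
    (hch : l.IsChain H.Adj) (x y : V) (hx : l.head? = some x) (hy : l.getLast? = some y)
    (hX : n + m ≤ ((Finset.univ \ l.toFinset).filter (H.Adj x)).card)
    (hY : m ≤ ((Finset.univ \ l.toFinset).filter (H.Adj y)).card) :
    HasCopy (LinkedDoubleStar (2 * p + 1) n m) H := by
  obtain ⟨B, hB, hBc⟩ := Finset.exists_subset_card_eq hY
  have : n ≤ (((Finset.univ \ l.toFinset).filter (H.Adj x)) \ B).card := by
    have := Finset.le_card_sdiff B ((Finset.univ \ l.toFinset).filter (H.Adj x))
    omega
  obtain ⟨A, hA, hAc⟩ := Finset.exists_subset_card_eq this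
  refine copy_of_list H _ n m (by omega) l hl hnd hch x y hx hy A B hAc hBc ?_ ?_ ?_
  · exact Finset.disjoint_of_subset_left hA Finset.sdiff_disjoint
  · intro v hv
    have := hA hv
    simp at this
    exact this.1
  · intro v hv
    have := hB hv
    simp at this
    exact this

theorem path_rotation {V : Type*} [DecidableEq V] (G : SimpleGraph V) [DecidableRel G.Adj]
    (Q : Finset V) (x : V) (h : RPath G Q x) :
    ∃ E ⊆ Q, E.card = (Q.filter (G.Adj x)).card ∧ ∀ e ∈ E, RPath G Q e := by
  obtain ⟨l, hnd, hch, hx, hQ⟩ := h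
  have key : ∀ y ∈ Q.filter (G.Adj x), ∃ e, RPath G Q e ∧
      ∃ i, l[i]? = some e ∧ l[i+1]? = some y := by
    intro y hy
    rw [Finset.mem_filter, ← hQ] at hy
    obtain ⟨hyl, hxy⟩ := hy
    obtain ⟨j, hj, hjy⟩ := List.mem_iff_getElem.1 hyl
    have h0 : l[0] = x := by
      rw [List.head?_eq_getElem?] at hx
      exact (List.getElem?_eq_some_iff.1 hx).2
    have hj0 : j ≠ 0 := by
      rintro rfl
      rw [h0] at hjy; subst hjy; exact G.loopless.irrefl _ hxy
    obtain ⟨i, rfl⟩ := Nat.exists_eq_succ_of_ne_zero hj0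
    refine ⟨l[i], ⟨(l.take (i+1)).reverse ++ l.drop (i+1), ?_, ?_, ?_, ?_⟩, i, ?_, ?_⟩
    · have : ((l.take (i+1)).reverse ++ l.drop (i+1)).Perm l := by
        conv_rhs => rw [← List.take_append_drop (i+1) l]
        exact (List.reverse_perm _).append_right _
      exact this.nodup_iff.2 hnd
    · rw [List.isChain_append]
      refine ⟨?_, hch.drop _, ?_⟩
      · rw [List.isChain_reverse]
        exact (hch.take _).imp fun a b h => h.symm
      · intro a ha b hb
        rw [List.getLast?_reverse, List.head?_take] at ha
        simp [hx] at ha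
        simp at hb
        obtain ⟨_, hb⟩ := List.getElem?_eq_some_iff.1 hb
        subst ha
        rw [← hb]
        simpa [hjy] using hxy
    · rw [List.head?_append, List.head?_reverse, List.getLast?_take]
      have : i < l.length := by omega
      simp [this]
    · intro v
      rw [← hQ, List.mem_append, List.mem_reverse, ← List.mem_append, List.take_append_drop]
    · simp
    · rw [← hjy]; simp
  choose! f hf using key
  refine ⟨(Q.filter (G.Adj x)).image f, ?_, ?_, ?_⟩
  · intro e he
    obtain ⟨y, hy, rfl⟩ := Finset.mem_image.1 he
    obtain ⟨_, i, hi, _⟩ := hf y hy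
    exact (hQ _).1 (List.mem_of_getElem? hi)
  · refine Finset.card_image_of_injOn ?_
    intro y hy y' hy' hyy
    obtain ⟨_, i, hi, hi'⟩ := hf y hy
    obtain ⟨_, j, hj, hj'⟩ := hf y' hy'
    rw [hyy] at hi
    obtain ⟨a1, a2⟩ := List.getElem?_eq_some_iff.1 hi
    obtain ⟨b1, b2⟩ := List.getElem?_eq_some_iff.1 hj
    have := (List.Nodup.getElem_inj_iff hnd).1 (a2.trans b2.symm)
    subst this
    rw [hi'] at hj'
    exact Option.some.inj hj'
  · intro e he
    obtain ⟨y, hy, rfl⟩ := Finset.mem_image.1 he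
    exact (hf y hy).1

/-- alternating path through `xs` with connectors in `Z`. -/
theorem alt_path {V : Type*} [DecidableEq V] (H : SimpleGraph V) [DecidableRel H.Adj]
    (Z : Finset V) (K : ℕ) : ∀ (q : ℕ) (xs : List V), xs.length = q + 1 → q ≤ K → xs.Nodup →
    (∀ v ∈ xs, v ∉ Z) →
    (∀ a ∈ xs, ∀ b ∈ xs, a ≠ b → K ≤ (Z.filter (fun z => H.Adj a z ∧ H.Adj b z)).card) →
    ∃ l : List V, l.length = 2 * q + 1 ∧ l.Nodup ∧ l.IsChain H.Adj ∧ l.head? = xs.head? ∧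
      l.getLast? = xs.getLast? ∧ ∃ U ⊆ Z, U.card = q ∧ ∀ v ∈ l, v ∈ xs ∨ v ∈ U := by
  intro q
  induction q with
  | zero =>
    intro xs hxs _ hnd _ _
    obtain ⟨a, rfl⟩ := List.length_eq_one_iff.1 hxs
    exact ⟨[a], by simp, by simp, by simp, rfl, rfl, ∅, by simp, by simp, by simp⟩
  | succ q ih =>
    intro xs hxs hK hnd hZ hcom
    match xs, hxs with
    | a :: b :: t, hxs =>
      obtain ⟨l, h1, h2, h3, h4, h5, U, hU, hUc, hl⟩ := ih (b :: t) (by simpa using hxs)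
        (by omega) (List.nodup_cons.1 hnd).2 (fun v hv => hZ v (List.mem_cons_of_mem _ hv))
        (fun c hc d hd => hcom c (List.mem_cons_of_mem _ hc) d (List.mem_cons_of_mem _ hd))
      have hab : a ≠ b := by
        rintro rfl
        simp at hnd
      have hc := hcom a (by simp) b (by simp) hab
      obtain ⟨z, hz, hzU⟩ := Finset.exists_mem_notMem_of_card_lt_card
        (show U.card < (Z.filter (fun z => H.Adj a z ∧ H.Adj b z)).card by omega)
      rw [Finset.mem_filter] at hz
      obtain ⟨hzZ, haz, hbz⟩ := hz
      have haZ := hZ a (by simp)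
      have haz' : a ≠ z := haz.ne
      have hal : a ∉ l := by
        intro h
        rcases hl a h with h | h
        · exact (List.nodup_cons.1 hnd).1 h
        · exact haZ (hU h)
      have hzl : z ∉ l := by
        intro h
        rcases hl z h with h | h
        · exact hZ z (List.mem_cons_of_mem _ h) hzZ
        · exact hzU h
      refine ⟨a :: z :: l, by simp [h1]; ring, ?_, ?_, by simp, ?_, insert z U, ?_, ?_, ?_⟩
      · simp [List.nodup_cons, hal, hzl, haz', h2]
      · rw [List.isChain_cons_cons, List.isChain_cons]
        refine ⟨haz, ?_, h3⟩
        intro y hy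
        rw [h4] at hy
        simp at hy
        subst hy
        exact hbz.symm
      · have : l ≠ [] := by rintro rfl; simp at h1
        rw [List.getLast?_cons_of_ne_nil (by simp), List.getLast?_cons_of_ne_nil this, h5]
        simp
      · intro v hv
        rcases Finset.mem_insert.1 hv with rfl | hv
        · exact hzZ
        · exact hU hv
      · rw [Finset.card_insert_of_notMem hzU, hUc]
      · intro v hv
        simp at hv
        rcases hv with rfl | rfl | hv
        · simp
        · simp
        · rcases hl v hv with h | h
          · left; exact List.mem_cons_of_mem _ h
          · right; exact Finset.mem_insert_of_mem h

theorem out_free {V : Type*} [Fintype V] [DecidableEq V] (H : SimpleGraph V)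
    [DecidableRel H.Adj] (p : ℕ) (l : List V) (hl : l.length = 2 * p + 1) (x : V) (hx : x ∈ l) :
    (Finset.univ.filter (H.Adj x)).card ≤
      ((Finset.univ \ l.toFinset).filter (H.Adj x)).card + 2 * p := by
  have h1 : Finset.univ.filter (H.Adj x) ⊆
      ((Finset.univ \ l.toFinset).filter (H.Adj x)) ∪ l.toFinset.erase x := by
    intro v hv
    simp only [Finset.mem_filter, Finset.mem_univ, true_and] at hv
    have := hv.ne'
    by_cases h : v ∈ l <;> simp [h, hv, this]
  have h2 := Finset.card_le_card h1
  have h3 := Finset.card_union_le ((Finset.univ \ l.toFinset).filter (H.Adj x))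
    (l.toFinset.erase x)
  have h4 : (l.toFinset.erase x).card + 1 = l.toFinset.card :=
    Finset.card_erase_add_one (by simpa using hx)
  have h5 := l.toFinset_card_le
  omega

theorem out_set {V : Type*} [Fintype V] [DecidableEq V] (H : SimpleGraph V)
    [DecidableRel H.Adj] (l : List V) (x : V) (Z U : Finset V) (hU : ∀ v ∈ l, v ∈ Z → v ∈ U) :
    (Z.filter (H.Adj x)).card ≤
      ((Finset.univ \ l.toFinset).filter (H.Adj x)).card + U.card := by
  have h1 : Z.filter (H.Adj x) ⊆ ((Finset.univ \ l.toFinset).filter (H.Adj x)) ∪ U := by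
    intro v hv
    simp only [Finset.mem_filter] at hv
    by_cases h : v ∈ l
    · simp [hU v h hv.1]
    · simp [h, hv]
  exact (Finset.card_le_card h1).trans (Finset.card_union_le _ _)

theorem finish_one {V : Type*} [Fintype V] [DecidableEq V] (H : SimpleGraph V)
    [DecidableRel H.Adj] (p n m : ℕ) (X Z : Finset V) (hX : X.card = p + 1)
    (hXZ : Disjoint X Z)
    (hcom : ∀ a ∈ X, ∀ b ∈ X, a ≠ b → p ≤ (Z.filter (fun z => H.Adj a z ∧ H.Adj b z)).card)
    (x0 : V) (hx0 : x0 ∈ X)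
    (hfree : n + m + 2 * p ≤ (Finset.univ.filter (H.Adj x0)).card ∨
      n + m + p ≤ (Z.filter (H.Adj x0)).card)
    (hmm : ∀ x ∈ X, m + p ≤ (Z.filter (H.Adj x)).card) :
    HasCopy (LinkedDoubleStar (2 * p + 1) n m) H := by
  have hmem : ∀ v, v ∈ x0 :: (X.erase x0).toList ↔ v ∈ X := by
    intro v
    by_cases h : v = x0 <;> simp [h, hx0]
  obtain ⟨l, h1, h2, h3, h4, h5, U, hU, hUc, hl⟩ := alt_path H Z p p (x0 :: (X.erase x0).toList)
    (by simp [Finset.card_erase_of_mem hx0, hX]) le_rfl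
    (by simp [Finset.nodup_toList])
    (fun v hv => Finset.disjoint_left.1 hXZ ((hmem v).1 hv))
    (fun a ha b hb => hcom a ((hmem a).1 ha) b ((hmem b).1 hb))
  obtain ⟨y, hy⟩ : ∃ y, l.getLast? = some y := by
    rw [h5]; exact ⟨_, List.getLast?_eq_some_getLast (by simp)⟩
  have hyX : y ∈ X := by
    rw [h5] at hy
    exact (hmem y).1 (List.mem_of_getLast? hy)
  have hUl : ∀ v ∈ l, v ∈ Z → v ∈ U := by
    intro v hv hvZ
    rcases hl v hv with h | h
    · exact absurd hvZ (Finset.disjoint_left.1 hXZ ((hmem v).1 h))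
    · exact h
  have hh : l.head? = some x0 := by rw [h4]; rfl
  refine copy_of_path H p n m l h1 h2 h3 x0 y hh hy ?_ ?_
  · rcases hfree with h | h
    · have := out_free H p l h1 x0 (List.mem_of_head? hh)
      omega
    · have := out_set H l x0 Z U hUl
      omega
  · have := out_set H l y Z U hUl
    have := hmm y hyX
    omega

theorem path_two {V : Type*} [Fintype V] [DecidableEq V] (H : SimpleGraph V)
    [DecidableRel H.Adj] (p : ℕ) (hp : 1 ≤ p) (E W : Finset V) (hE : E.card = p) (y z : V)
    (hEW : Disjoint E W) (hEz : ∀ e ∈ E, H.Adj e z) (hEadj : ∀ e ∈ E, ∀ w ∈ W, H.Adj e w)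
    (hyE : y ∉ E) (hyW : y ∉ W) (hzW : z ∉ W) (hyz : H.Adj y z) (hW : p - 1 ≤ W.card) :
    ∃ l : List V, ∃ e ∈ E, l.length = 2 * p + 1 ∧ l.Nodup ∧ l.IsChain H.Adj ∧
      l.head? = some y ∧ l.getLast? = some e ∧ ∃ U ⊆ W, U.card = p - 1 ∧
      ∀ v ∈ l, v = y ∨ v = z ∨ v ∈ E ∨ v ∈ U := by
  have hne : E.toList ≠ [] := by
    intro h
    have := congrArg List.length h
    simp at this
    subst this
    simp at hE
    omega
  obtain ⟨l, h1, h2, h3, h4, h5, U, hU, hUc, hl⟩ := alt_path H W (p - 1) (p - 1) E.toList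
    (by simp [hE]; omega) le_rfl E.nodup_toList
    (fun v hv => Finset.disjoint_left.1 hEW (by simpa using hv))
    (by
      intro a ha b hb _
      rw [Finset.filter_true_of_mem]
      · exact hW
      · intro w hw
        exact ⟨hEadj a (by simpa using ha) w hw, hEadj b (by simpa using hb) w hw⟩)
  have hzE : z ∉ E := fun h => (hEz z h).ne rfl
  have hyl : y ∉ l := by
    intro h
    rcases hl y h with h | h
    · exact hyE (by simpa using h)
    · exact hyW (hU h)
  have hzl : z ∉ l := by
    intro h
    rcases hl z h with h | h
    · exact hzE (by simpa using h)
    · exact hzW (hU h)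
  have hlne : l ≠ [] := by rintro rfl; simp at h1
  refine ⟨y :: z :: l, E.toList.getLast hne, ?_, ?_, ?_, ?_, rfl, ?_, U, hU, hUc, ?_⟩
  · exact Finset.mem_toList.1 (List.getLast_mem hne)
  · simp [h1]; omega
  · simp [hyl, hzl, h2, hyz.ne]
  · rw [List.isChain_cons_cons, List.isChain_cons]
    refine ⟨hyz, ?_, h3⟩
    intro w hw
    rw [h4] at hw
    exact (hEz w (Finset.mem_toList.1 (List.mem_of_head? hw))).symm
  · rw [List.getLast?_cons_of_ne_nil (by simp), List.getLast?_cons_of_ne_nil hlne, h5,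
      List.getLast?_eq_some_getLast hne]
  · intro v hv
    simp at hv
    rcases hv with h | h | h
    · exact Or.inl h
    · exact Or.inr (Or.inl h)
    · rcases hl v h with h | h
      · exact Or.inr (Or.inr (Or.inl (by simpa using h)))
      · exact Or.inr (Or.inr (Or.inr h))

/-- a free vertex `y` together with `p` vertices complete to `Z`. -/
theorem finish_two {V : Type*} [Fintype V] [DecidableEq V] (H : SimpleGraph V)
    [DecidableRel H.Adj] (p n m : ℕ) (hp : 1 ≤ p) (E Z : Finset V) (hE : E.card = p) (y z : V)
    (hEZ : Disjoint E Z) (hEadj : ∀ e ∈ E, ∀ w ∈ Z, H.Adj e w)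
    (hyE : y ∉ E) (hyZ : y ∉ Z) (hz : z ∈ Z) (hyz : H.Adj y z) (hZ : m + p ≤ Z.card)
    (hfree : n + m + 2 * p ≤ (Finset.univ.filter (H.Adj y)).card) :
    HasCopy (LinkedDoubleStar (2 * p + 1) n m) H := by
  obtain ⟨l, e, he, h1, h2, h3, h4, h5, U, hU, hUc, hl⟩ := path_two H p hp E (Z.erase z) hE y z
    (hEZ.mono_right (Finset.erase_subset _ _)) (fun e he => hEadj e he z hz)
    (fun e he w hw => hEadj e he w (Finset.mem_of_mem_erase hw)) hyE
    (fun h => hyZ (Finset.mem_of_mem_erase h)) (by simp) hyz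
    (by rw [Finset.card_erase_of_mem hz]; omega)
  refine copy_of_path H p n m l h1 h2 h3 y e h4 h5 ?_ ?_
  · have := out_free H p l h1 y (List.mem_of_head? h4)
    omega
  · have := out_set H l e Z (insert z U) (by
      intro v hv hvZ
      rcases hl v hv with h | h | h | h
      · exact absurd (h ▸ hvZ) hyZ
      · simp [h]
      · exact absurd hvZ (Finset.disjoint_left.1 hEZ h)
      · simp [h])
    have h6 := Finset.card_insert_le z U
    rw [Finset.filter_true_of_mem (hEadj e he)] at this
    omega

/-- `p` vertices complete to a large `Z` together with a vertex of moderate degree to `Z`. -/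
theorem finish_three {V : Type*} [Fintype V] [DecidableEq V] (H : SimpleGraph V)
    [DecidableRel H.Adj] (p n m : ℕ) (hp : 1 ≤ p) (E Z : Finset V) (hE : E.card = p) (y : V)
    (hEZ : Disjoint E Z) (hEadj : ∀ e ∈ E, ∀ w ∈ Z, H.Adj e w)
    (hyE : y ∉ E) (hyZ : y ∉ Z) (hZ : n + m + p ≤ Z.card)
    (hdeg : m + 1 ≤ (Z.filter (H.Adj y)).card) :
    HasCopy (LinkedDoubleStar (2 * p + 1) n m) H := by
  obtain ⟨M, hM, hMc⟩ := Finset.exists_subset_card_eq hdeg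
  have hMZ : M ⊆ Z := hM.trans (Finset.filter_subset _ _)
  obtain ⟨z, hzM⟩ : M.Nonempty := Finset.card_pos.1 (by omega)
  have hyz : H.Adj y z := (Finset.mem_filter.1 (hM hzM)).2
  have hcard := Finset.card_sdiff_of_subset hMZ
  obtain ⟨l, e, he, h1, h2, h3, h4, h5, U, hU, hUc, hl⟩ := path_two H p hp E (Z \ M) hE y z
    (hEZ.mono_right Finset.sdiff_subset) (fun e he => hEadj e he z (hMZ hzM))
    (fun e he w hw => hEadj e he w (Finset.sdiff_subset hw)) hyE
    (fun h => hyZ (Finset.sdiff_subset h)) (by simp [hzM]) hyz (by omega)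
  have hhead : l.reverse.head? = some e := by rw [List.head?_reverse, h5]
  have hlast : l.reverse.getLast? = some y := by rw [List.getLast?_reverse, h4]
  refine copy_of_path H p n m l.reverse (by simpa using h1) (by simpa using h2)
    (by rw [List.isChain_reverse]; exact h3.imp fun a b h => h.symm) e y hhead hlast ?_ ?_
  · have := out_set H l.reverse e Z (insert z U) (by
      intro v hv hvZ
      rcases hl v (by simpa using hv) with h | h | h | h
      · exact absurd (h ▸ hvZ) hyZ
      · simp [h]
      · exact absurd hvZ (Finset.disjoint_left.1 hEZ h)
      · simp [h])
    have h6 := Finset.card_insert_le z U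
    rw [Finset.filter_true_of_mem (hEadj e he)] at this
    omega
  · have := out_set H l.reverse y M {z} (by
      intro v hv hvM
      rcases hl v (by simpa using hv) with h | h | h | h
      · exact absurd (h ▸ hMZ hvM) hyZ
      · simp [h]
      · exact absurd (hMZ hvM) (Finset.disjoint_left.1 hEZ h)
      · exact absurd hvM (Finset.mem_sdiff.1 (hU h)).2)
    rw [Finset.filter_true_of_mem (fun v hv => (Finset.mem_filter.1 (hM hv)).2)] at this
    rw [Finset.card_singleton] at this
    omega

theorem blue_card {V : Type*} [Fintype V] [DecidableEq V] (G : SimpleGraph V)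
    [DecidableRel G.Adj] (S : Finset V) (x : V) (hx : x ∉ S) :
    (S.filter (Gᶜ.Adj x)).card + (S.filter (G.Adj x)).card = S.card := by
  rw [add_comm, ← Finset.card_filter_add_card_filter_not (s := S) (G.Adj x)]
  congr 2
  refine Finset.filter_congr fun v hv => ?_
  rw [SimpleGraph.compl_adj]
  have : x ≠ v := by rintro rfl; exact hx hv
  simp [this]

theorem blue_common {V : Type*} [Fintype V] [DecidableEq V] (G : SimpleGraph V)
    [DecidableRel G.Adj] (S : Finset V) (x y : V) (hx : x ∉ S) (hy : y ∉ S) :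
    S.card ≤ (S.filter (fun z => Gᶜ.Adj x z ∧ Gᶜ.Adj y z)).card + (S.filter (G.Adj x)).card
      + (S.filter (G.Adj y)).card := by
  have : S ⊆ (S.filter (fun z => Gᶜ.Adj x z ∧ Gᶜ.Adj y z)) ∪ (S.filter (G.Adj x)) ∪
      (S.filter (G.Adj y)) := by
    intro v hv
    have h1 : x ≠ v := by rintro rfl; exact hx hv
    have h2 : y ≠ v := by rintro rfl; exact hy hv
    simp only [Finset.mem_union, Finset.mem_filter, hv, true_and, SimpleGraph.compl_adj, ne_eq,
      h1, h2, not_false_eq_true]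
    tauto
  refine (Finset.card_le_card this).trans ((Finset.card_union_le _ _).trans ?_)
  have := Finset.card_union_le (S.filter (fun z => Gᶜ.Adj x z ∧ Gᶜ.Adj y z)) (S.filter (G.Adj x))
  omega

theorem max_path {V : Type*} [Fintype V] [DecidableEq V] (G : SimpleGraph V)
    (S : Finset V) (hS : S.Nonempty) (T : ℕ) (hT : 1 ≤ T) :
    ∃ Q ⊆ S, Q.card ≤ T ∧ (∃ x ∈ Q, RPath G Q x) ∧
      (Q.card = T ∨ ∀ e, RPath G Q e → ∀ v ∈ S \ Q, ¬ G.Adj e v) := by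
  classical
  let F := S.powerset.filter (fun Q => Q.card ≤ T ∧ ∃ x ∈ Q, RPath G Q x)
  have hF : F.Nonempty := by
    obtain ⟨s, hs⟩ := hS
    refine ⟨{s}, ?_⟩
    simp only [F, Finset.mem_filter, Finset.mem_powerset, Finset.singleton_subset_iff]
    exact ⟨hs, by simpa using hT, s, by simp, [s], by simp, by simp, rfl, by simp⟩
  obtain ⟨Q, hQ, hmax⟩ := Finset.exists_max_image F Finset.card hF
  simp only [F, Finset.mem_filter, Finset.mem_powerset] at hQ hmax
  refine ⟨Q, hQ.1, hQ.2.1, hQ.2.2, ?_⟩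
  by_contra hcon
  push Not at hcon
  obtain ⟨hne, e, ⟨l, h1, h2, h3, h4⟩, v, hv, hev⟩ := hcon
  rw [Finset.mem_sdiff] at hv
  have hlt := hQ.2.1
  have hc := Finset.card_insert_of_notMem hv.2
  have := hmax (insert v Q) ⟨?_, ?_, v, by simp, v :: l, ?_, ?_, rfl, ?_⟩
  · omega
  · exact Finset.insert_subset hv.1 hQ.1
  · omega
  · rw [List.nodup_cons, h4]; exact ⟨hv.2, h1⟩
  · rw [List.isChain_cons]
    refine ⟨?_, h2⟩
    intro y hy
    rw [h3] at hy
    obtain rfl := Option.some.inj hy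
    exact hev.symm
  · intro w
    simp [h4]

theorem red_end {V : Type*} [Fintype V] [DecidableEq V] (G : SimpleGraph V)
    [DecidableRel G.Adj] (p n m : ℕ) (u : V) (hp : 1 ≤ p)
    (hdu : n + m + 2 * p ≤ (Finset.univ.filter (G.Adj u)).card)
    (hno : ¬ HasCopy (LinkedDoubleStar (2 * p + 1) n m) G)
    (Q : Finset V) (hQ : Q ⊆ Finset.univ.filter (G.Adj u)) (hQc : Q.card = 2 * p) (x : V)
    (hx : RPath G Q x) :
    ((Finset.univ \ insert u Q).filter (G.Adj x)).card < m := by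
  obtain ⟨l, h1, h2, h3, h4⟩ := hx
  by_contra hcon
  push Not at hcon
  apply hno
  have htf : l.toFinset = Q := by ext v; simp [h4]
  have hu : u ∉ l := by
    rw [h4]
    intro h
    have := hQ h
    simp at this
  have hlen : l.length = 2 * p := by
    rw [← hQc, ← htf, List.toFinset_card_of_nodup h1]
  have hlne : l.reverse ≠ [] := by
    intro h
    rw [List.reverse_eq_nil_iff] at h
    subst h
    simp at hlen
    omega
  have hlast : (u :: l.reverse).getLast? = some x := by
    rw [List.getLast?_cons_of_ne_nil hlne, List.getLast?_reverse, h3]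
  have hL : (u :: l.reverse).length = 2 * p + 1 := by simp [hlen]
  refine copy_of_path G p n m (u :: l.reverse) hL ?_ ?_ u x rfl hlast ?_ ?_
  · simp [hu, h1]
  · rw [List.isChain_cons]
    refine ⟨?_, ?_⟩
    · intro y hy
      have : y ∈ Q := by
        rw [← h4]
        simpa using List.mem_of_head? hy
      simpa using hQ this
    · rw [List.isChain_reverse]
      exact h2.imp fun a b h => h.symm
  · have := out_free G p (u :: l.reverse) hL u (by simp)
    omega
  · have : (u :: l.reverse).toFinset = insert u Q := by
      ext v; simp [h4]
    rw [this]
    exact hcon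

theorem step_lemma {V : Type*} [Fintype V] [DecidableEq V] (G : SimpleGraph V)
    [DecidableRel G.Adj] (p n m : ℕ) (u : V) (hp : 1 ≤ p) (hn : p + 3 ≤ n) (hm : 2 ≤ m)
    (hV : Fintype.card V = 2 * (n + m + p) - 1)
    (hdu : n + m + 3 * p ≤ (Finset.univ.filter (G.Adj u)).card)
    (hno : ¬ HasCopy (LinkedDoubleStar (2 * p + 1) n m) G)
    (hnob : ¬ HasCopy (LinkedDoubleStar (2 * p + 1) n m) Gᶜ)
    (S : Finset V) (hS : S ⊆ Finset.univ.filter (G.Adj u)) (hSn : S.Nonempty) :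
    (∃ x ∈ S, (Finset.univ.filter (G.Adj x)).card ≤ p + m ∨ (S.filter (G.Adj x)).card < p) ∨
    (∃ Q ⊆ S, Q.card < 2 * p ∧ ∃ E ⊆ Q, E.card = p ∧ ∀ e ∈ E, ∀ w ∈ S \ Q, Gᶜ.Adj e w) := by
  obtain ⟨Q, hQS, hQc, ⟨x, hxQ, hx⟩, h⟩ := max_path G S hSn (2 * p) (by omega)
  obtain ⟨E, hEQ, hEc, hE⟩ := path_rotation G Q x hx
  by_cases hc : Q.card = 2 * p
  · left
    have hend := red_end G p n m u hp (by omega) hno Q (hQS.trans hS) hc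
    by_cases hd : p + 1 ≤ E.card
    · exfalso
      obtain ⟨X, hXE, hXc⟩ := Finset.exists_subset_card_eq hd
      have huQ : u ∉ Q := fun h => by simpa using hS (hQS h)
      have hZc : (Finset.univ \ insert u Q).card = 2 * n + 2 * m - 2 := by
        rw [Finset.card_sdiff_of_subset (Finset.subset_univ _), Finset.card_insert_of_notMem huQ,
          Finset.card_univ, hV, hc]
        omega
      have hXZ : ∀ a ∈ X, a ∉ Finset.univ \ insert u Q := by
        intro a ha
        simp [hEQ (hXE ha)]
      obtain ⟨x0, hx0⟩ : X.Nonempty := Finset.card_pos.1 (by omega)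
      have hb : ∀ a ∈ X, 2 * n + m - 1 ≤
          ((Finset.univ \ insert u Q).filter (Gᶜ.Adj a)).card := by
        intro a ha
        have h1 := blue_card G _ a (hXZ a ha)
        have h2 := hend a (hE a (hXE ha))
        omega
      refine hnob (finish_one Gᶜ p n m X (Finset.univ \ insert u Q) hXc
        (Finset.disjoint_left.2 hXZ) ?_ x0 hx0 (Or.inr ?_) ?_)
      · intro a ha b hb _
        have h1 := blue_common G _ a b (hXZ a ha) (hXZ b hb)
        have h2 := hend a (hE a (hXE ha))
        have h3 := hend b (hE b (hXE hb))
        omega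
      · have := hb x0 hx0
        omega
      · intro a ha
        have := hb a ha
        omega
    · refine ⟨x, hQS hxQ, Or.inl ?_⟩
      have h1 : Finset.univ.filter (G.Adj x) ⊆
          ((Finset.univ \ insert u Q).filter (G.Adj x)) ∪ (insert u (Q.filter (G.Adj x))) := by
        intro v hv
        simp only [Finset.mem_filter, Finset.mem_univ, true_and] at hv
        simp [hv]
        tauto
      have h2 := (Finset.card_le_card h1).trans (Finset.card_union_le _ _)
      have h3 := Finset.card_insert_le u (Q.filter (G.Adj x))
      have h4 := hend x hx
      omega
  · have h := h.resolve_left hc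
    by_cases hd : p ≤ E.card
    · right
      obtain ⟨X, hXE, hXc⟩ := Finset.exists_subset_card_eq hd
      refine ⟨Q, hQS, by omega, X, hXE.trans hEQ, hXc, ?_⟩
      intro e he w hw
      rw [SimpleGraph.compl_adj]
      refine ⟨?_, h e (hE e (hXE he)) w hw⟩
      rintro rfl
      exact (Finset.mem_sdiff.1 hw).2 (hEQ (hXE he))
    · left
      refine ⟨x, hQS hxQ, Or.inr ?_⟩
      have : S.filter (G.Adj x) = Q.filter (G.Adj x) := by
        ext v
        simp only [Finset.mem_filter]
        constructor
        · rintro ⟨hv, hxv⟩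
          refine ⟨?_, hxv⟩
          by_contra hvQ
          exact h x hx v (by simp [hv, hvQ]) hxv
        · rintro ⟨hv, hxv⟩
          exact ⟨hQS hv, hxv⟩
      rw [this]
      omega

theorem first_vertex {V : Type*} [Fintype V] [DecidableEq V] (G : SimpleGraph V)
    [DecidableRel G.Adj] (p n m : ℕ) (u : V) (hp : 1 ≤ p) (hn : p + 3 ≤ n) (hm : 2 ≤ m)
    (hV : Fintype.card V = 2 * (n + m + p) - 1)
    (hdu : n + m + 3 * p ≤ (Finset.univ.filter (G.Adj u)).card)
    (hno : ¬ HasCopy (LinkedDoubleStar (2 * p + 1) n m) G)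
    (hnob : ¬ HasCopy (LinkedDoubleStar (2 * p + 1) n m) Gᶜ) :
    ∃ x ∈ Finset.univ.filter (G.Adj u), (Finset.univ.filter (G.Adj x)).card ≤ p + m ∨
      ((Finset.univ.filter (G.Adj u)).filter (G.Adj x)).card < p := by
  set R := Finset.univ.filter (G.Adj u) with hR
  have hstep := step_lemma G p n m u hp hn hm hV hdu hno hnob
  rcases hstep R (subset_refl _) (Finset.card_pos.1 (by omega)) with h | h
  · exact h
  obtain ⟨Q, hQ, hQc, E, hEQ, hEc, hE⟩ := h
  have hc := Finset.card_sdiff_of_subset hQ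
  have key : ∀ y ∈ R \ Q, ((R \ Q).filter (G.Adj y)).card ≤ 2 * p - 2 → False := by
    intro y hy hyd
    have hyQ := (Finset.mem_sdiff.1 hy).2
    have hec := Finset.card_erase_of_mem hy
    refine hnob (finish_three Gᶜ p n m hp E ((R \ Q).erase y) hEc y ?_ ?_
      (fun h => hyQ (hEQ h)) (by simp) ?_ ?_)
    · rw [Finset.disjoint_left]
      intro a ha
      simp [hEQ ha]
    · intro e he w hw
      exact hE e he w (Finset.mem_of_mem_erase hw)
    · omega
    · have h1 := blue_card G ((R \ Q).erase y) y (by simp)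
      have h2 : (((R \ Q).erase y).filter (G.Adj y)).card ≤ ((R \ Q).filter (G.Adj y)).card :=
        Finset.card_le_card (Finset.filter_subset_filter _ (Finset.erase_subset _ _))
      omega
  rcases hstep (R \ Q) Finset.sdiff_subset (Finset.card_pos.1 (by omega)) with h | h
  · obtain ⟨y, hy, h | h⟩ := h
    · exact ⟨y, Finset.sdiff_subset hy, Or.inl h⟩
    · by_cases hp1 : p = 1
      · exact (key y hy (by omega)).elim
      · exact (key y hy (by omega)).elim
  · obtain ⟨Q', hQ', hQc', E', hEQ', hEc', hE'⟩ := h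
    obtain ⟨e, he⟩ : E'.Nonempty := Finset.card_pos.1 (by omega)
    exfalso
    refine key e (hQ' (hEQ' he)) ?_
    have hsub : (R \ Q).filter (G.Adj e) ⊆ Q'.erase e := by
      intro v hv
      rw [Finset.mem_filter] at hv
      rw [Finset.mem_erase]
      refine ⟨hv.2.ne', ?_⟩
      by_contra hvQ
      have := hE' e he v (Finset.mem_sdiff.2 ⟨hv.1, hvQ⟩)
      rw [SimpleGraph.compl_adj] at this
      exact this.2 hv.2
    have h1 := Finset.card_le_card hsub
    rw [Finset.card_erase_of_mem (hEQ' he)] at h1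
    omega

theorem lds_core {V : Type*} [Fintype V] [DecidableEq V] (G : SimpleGraph V)
    [DecidableRel G.Adj] (p n m : ℕ) (u : V) (hp : 1 ≤ p) (hn : p + 3 ≤ n) (hm : 2 ≤ m)
    (hV : Fintype.card V = 2 * (n + m + p) - 1)
    (hdu : n + m + 3 * p ≤ (Finset.univ.filter (G.Adj u)).card)
    (hno : ¬ HasCopy (LinkedDoubleStar (2 * p + 1) n m) G)
    (hnob : ¬ HasCopy (LinkedDoubleStar (2 * p + 1) n m) Gᶜ) : False := by
  have hstep := step_lemma G p n m u hp hn hm hV hdu hno hnob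
  obtain ⟨x0, hx0R, hx0⟩ := first_vertex G p n m u hp hn hm hV hdu hno hnob
  set R := Finset.univ.filter (G.Adj u) with hR
  have hfree : n + m + 2 * p ≤ (Finset.univ.filter (Gᶜ.Adj x0)).card := by
    rcases hx0 with h | h
    · have h1 := blue_card G (Finset.univ.erase x0) x0 (by simp)
      have h2 : ((Finset.univ.erase x0).filter (G.Adj x0)).card ≤
          (Finset.univ.filter (G.Adj x0)).card :=
        Finset.card_le_card (Finset.filter_subset_filter _ (Finset.erase_subset _ _))
      have h3 : ((Finset.univ.erase x0).filter (Gᶜ.Adj x0)).card ≤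
          (Finset.univ.filter (Gᶜ.Adj x0)).card :=
        Finset.card_le_card (Finset.filter_subset_filter _ (Finset.erase_subset _ _))
      rw [Finset.card_erase_of_mem (Finset.mem_univ _), Finset.card_univ, hV] at h1
      omega
    · have h1 := blue_card G (R.erase x0) x0 (by simp)
      have h2 : ((R.erase x0).filter (G.Adj x0)).card ≤ (R.filter (G.Adj x0)).card :=
        Finset.card_le_card (Finset.filter_subset_filter _ (Finset.erase_subset _ _))
      have h3 : ((R.erase x0).filter (Gᶜ.Adj x0)).card ≤
          (Finset.univ.filter (Gᶜ.Adj x0)).card :=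
        Finset.card_le_card (Finset.filter_subset_filter _ (Finset.subset_univ _))
      rw [Finset.card_erase_of_mem hx0R] at h1
      omega
  have hx0m : (R.filter (G.Adj x0)).card ≤ p + m := by
    rcases hx0 with h | h
    · exact (Finset.card_le_card
        (Finset.filter_subset_filter _ (Finset.subset_univ _))).trans h
    · omega
  have hiter : ∀ j, j ≤ p → ∃ X ⊆ R, X.card = j + 1 ∧ x0 ∈ X ∧ ∀ x ∈ X,
      (Finset.univ.filter (G.Adj x)).card ≤ p + m ∨ ((R \ X).filter (G.Adj x)).card < p := by
    intro j
    induction j with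
    | zero =>
      intro _
      refine ⟨{x0}, by simpa using hx0R, by simp, by simp, ?_⟩
      intro x hx
      rw [Finset.mem_singleton] at hx
      subst hx
      refine hx0.imp_right fun h => lt_of_le_of_lt (Finset.card_le_card
        (Finset.filter_subset_filter _ Finset.sdiff_subset)) h
    | succ j ih =>
      intro hj
      obtain ⟨X, hXR, hXc, hxX, hX⟩ := ih (by omega)
      have hc := Finset.card_sdiff_of_subset hXR
      rcases hstep (R \ X) Finset.sdiff_subset (Finset.card_pos.1 (by omega)) with h | h
      · obtain ⟨x, hx, h⟩ := h
        rw [Finset.mem_sdiff] at hx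
        have hmono : ∀ y, ((R \ insert x X).filter (G.Adj y)).card ≤
            ((R \ X).filter (G.Adj y)).card := fun y =>
          Finset.card_le_card (Finset.filter_subset_filter _
            (Finset.sdiff_subset_sdiff (subset_refl _) (Finset.subset_insert _ _)))
        refine ⟨insert x X, Finset.insert_subset hx.1 hXR, ?_, ?_, ?_⟩
        · rw [Finset.card_insert_of_notMem hx.2, hXc]
        · exact Finset.mem_insert_of_mem hxX
        · intro y hy
          rcases Finset.mem_insert.1 hy with rfl | hy
          · exact h.imp_right fun h => lt_of_le_of_lt (hmono _) h
          · exact (hX y hy).imp_right fun h => lt_of_le_of_lt (hmono _) h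
      · exfalso
        obtain ⟨Q, hQ, hQc, E, hEQ, hEc, hE⟩ := h
        have hc2 := Finset.card_sdiff_of_subset hQ
        have hx0S : x0 ∉ R \ X := by simp [hxX]
        have hx0Z : x0 ∉ (R \ X) \ Q := fun h => hx0S (Finset.sdiff_subset h)
        have h1 := blue_card G ((R \ X) \ Q) x0 hx0Z
        have h2 : ((((R \ X) \ Q)).filter (G.Adj x0)).card ≤ (R.filter (G.Adj x0)).card :=
          Finset.card_le_card (Finset.filter_subset_filter _
            (Finset.sdiff_subset.trans Finset.sdiff_subset))
        obtain ⟨z, hz⟩ : ((((R \ X) \ Q)).filter (Gᶜ.Adj x0)).Nonempty :=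
          Finset.card_pos.1 (by omega)
        rw [Finset.mem_filter] at hz
        refine hnob (finish_two Gᶜ p n m hp E ((R \ X) \ Q) hEc x0 z ?_ hE
          (fun h => hx0S (hQ (hEQ h))) hx0Z hz.1 hz.2 (by omega) hfree)
        rw [Finset.disjoint_left]
        intro a ha
        simp [hEQ ha]
  obtain ⟨X, hXR, hXc, hxX, hX⟩ := hiter p le_rfl
  have hc := Finset.card_sdiff_of_subset hXR
  have hcZ : (Finset.univ \ X).card = 2 * (n + m + p) - 1 - (p + 1) := by
    rw [Finset.card_sdiff_of_subset (Finset.subset_univ _), Finset.card_univ, hV, hXc]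
  have hZ : ∀ a ∈ X, a ∉ Finset.univ \ X := fun a ha => by simp [ha]
  have hW : ∀ a ∈ X, a ∉ R \ X := fun a ha => by simp [ha]
  have hle1 : ∀ a, ((Finset.univ \ X).filter (G.Adj a)).card ≤
      (Finset.univ.filter (G.Adj a)).card := fun a =>
    Finset.card_le_card (Finset.filter_subset_filter _ Finset.sdiff_subset)
  have hle2 : ∀ a, ((R \ X).filter (G.Adj a)).card ≤
      (Finset.univ.filter (G.Adj a)).card := fun a =>
    Finset.card_le_card (Finset.filter_subset_filter _ (Finset.subset_univ _))
  have hsub : R \ X ⊆ Finset.univ \ X :=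
    Finset.sdiff_subset_sdiff (Finset.subset_univ _) (subset_refl _)
  refine hnob (finish_one Gᶜ p n m X (Finset.univ \ X) hXc (Finset.disjoint_left.2 hZ) ?_ x0 hxX
    (Or.inl hfree) ?_)
  · intro a ha b hb _
    have h1 := blue_common G (Finset.univ \ X) a b (hZ a ha) (hZ b hb)
    have h2 := blue_common G (R \ X) a b (hW a ha) (hW b hb)
    have h3 : ((R \ X).filter (fun z => Gᶜ.Adj a z ∧ Gᶜ.Adj b z)).card ≤
        ((Finset.univ \ X).filter (fun z => Gᶜ.Adj a z ∧ Gᶜ.Adj b z)).card :=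
      Finset.card_le_card (Finset.filter_subset_filter _ hsub)
    have h4 := hle1 a
    have h5 := hle1 b
    have h6 := hle2 a
    have h7 := hle2 b
    rcases hX a ha with h | h <;> rcases hX b hb with h' | h' <;> omega
  · intro a ha
    have h1 := blue_card G (Finset.univ \ X) a (hZ a ha)
    have h2 := blue_card G (R \ X) a (hW a ha)
    have h3 : ((R \ X).filter (Gᶜ.Adj a)).card ≤
        ((Finset.univ \ X).filter (Gᶜ.Adj a)).card :=
      Finset.card_le_card (Finset.filter_subset_filter _ hsub)
    have h4 := hle1 a
    rcases hX a ha with h | h <;> omega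

/-- if `u` has maximum monochromatic degree with
`red-d(u) ≥ n + m + 3p`, and `n ≥ p + 3`, `m ≥ 2`, then there is a
monochromatic `S_c(n,m)`. -/
theorem lds_large_k (n m p : ℕ) (hm : 2 ≤ m) (hmn : m ≤ n) (hp : 1 ≤ p)
    (hn : p + 3 ≤ n) {V : Type*} [Fintype V]
    (hV : Fintype.card V = 2 * (n + m + p) - 1) (G : SimpleGraph V) (u : V)
    (hmaxr : ∀ v : V, ({w | G.Adj v w}).ncard ≤ ({w | G.Adj u w}).ncard)
    (hmaxb : ∀ v : V, ({w | Gᶜ.Adj v w}).ncard ≤ ({w | G.Adj u w}).ncard)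
    (hdu : n + m + 3 * p ≤ ({w | G.Adj u w}).ncard) :
    HasMonoLDS G (2 * p + 1) n m := by
  classical
  have hdu' : n + m + 3 * p ≤ (Finset.univ.filter (G.Adj u)).card := by
    rw [← Set.ncard_coe_finset]
    simpa using hdu
  by_contra hcon
  rw [HasMonoLDS, not_or] at hcon
  exact lds_core G p n m u hp hn hm hV hdu' hcon.1 hcon.2
end

section
/- Let p ≥ 1 and n be integers with 2 ≤ n ≤ p, and set c = 2p+1. Consider a 2-coloring of the edges of the complete graph on a vertex set V with |V| = n + 3p + 3. Let Q be a blue cycle on 2p+2 vertices such that s(Q) ≥ s(C) for every monochromatic cycle C on 2p+2 vertices in this coloring. If s(Q) ≤ p − 1, then the coloring contains a monochromatic copy of S_c(n,2). -/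
open SimpleGraph

/-- Adjacency of `H` between `A` and `B`. -/
def bipRel {V : Type*} (H : SimpleGraph V) (A B : Finset V) (u v : V) : Prop :=
  H.Adj u v ∧ (u ∈ A ∧ v ∈ B ∨ u ∈ B ∧ v ∈ A)

theorem bipRel_symm {V : Type*} {H : SimpleGraph V} {A B : Finset V} {u v : V}
    (h : bipRel H A B u v) : bipRel H A B v u :=
  ⟨h.1.symm, by have := h.2; tauto⟩

/-- `l` is a cyclic list alternating between `S ⊆ A` and `B`, covering all of `S`. -/
structure GoodCyc {V : Type*} (H : SimpleGraph V) (A B S : Finset V) (l : List V) : Prop where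
  nodup : l.Nodup
  chain : (l : Cycle V).Chain (bipRel H A B)
  len : l.length = 2 * S.card
  sub : ∀ v ∈ l, v ∈ S ∨ v ∈ B
  cov : ∀ v ∈ S, v ∈ l

theorem GoodCyc.rot {V : Type*} {H : SimpleGraph V} {A B S : Finset V} {l l' : List V}
    (h : GoodCyc H A B S l) (hr : l ~r l') : GoodCyc H A B S l' where
  nodup := hr.nodup_iff.1 h.nodup
  chain := by
    have := h.chain
    rwa [Cycle.coe_eq_coe.2 hr] at this
  len := by rw [← hr.perm.length_eq, h.len]
  sub := fun v hv => h.sub v (hr.mem_iff.2 hv)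
  cov := fun v hv => hr.mem_iff.1 (h.cov v hv)

theorem rot_to {V : Type*} {l : List V} {y : V} (hy : y ∈ l) : ∃ r, l ~r (y :: r) := by
  obtain ⟨s, t, rfl⟩ := List.append_of_mem hy
  exact ⟨t ++ s, by simpa using (List.isRotated_append (l := s) (l' := y :: t))⟩

theorem GoodCyc.succ {V : Type*} {H : SimpleGraph V} {A B S : Finset V} {l : List V}
    (h : GoodCyc H A B S l) {y : V} (hy : y ∈ l) :
    ∃ x r, l ~r (y :: x :: r) ∧ bipRel H A B y x := by
  obtain ⟨r, hr⟩ := rot_to hy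
  have h' := h.rot hr
  rcases r with _ | ⟨x, r⟩
  · have := h'.len
    simp at this
    omega
  · have := h'.chain
    rw [Cycle.chain_coe_cons] at this
    simp at this
    exact ⟨x, r, hr, this.1⟩

theorem GoodCyc.card_out {V : Type*} [DecidableEq V] {H : SimpleGraph V} {A B S : Finset V}
    {l : List V} (h : GoodCyc H A B S l) (hSA : S ⊆ A) (hd : Disjoint A B) :
    (B ∩ l.toFinset).card = S.card := by
  have e : l.toFinset = S ∪ (B ∩ l.toFinset) := by
    ext v
    have := h.sub v
    have := h.cov v
    simp
    tauto
  have hd' : Disjoint S (B ∩ l.toFinset) :=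
    (Finset.disjoint_of_subset_left hSA hd).mono_right Finset.inter_subset_left
  have h1 := Finset.card_union_of_disjoint hd'
  rw [← e, List.toFinset_card_of_nodup h.nodup, h.len] at h1
  omega

theorem ins1 {V : Type*} [DecidableEq V] {H : SimpleGraph V} {A B S : Finset V} {l : List V}
    (h : GoodCyc H A B S l) {a u y x : V} {r : List V} (ha : a ∉ S) (hal : a ∉ l)
    (hr : l ~r (y :: x :: r)) (hy : bipRel H A B y a) (hu : u ∉ l) (huB : u ∈ B)
    (h1 : bipRel H A B a u) (h2 : bipRel H A B u x) :
    ∃ l', GoodCyc H A B (insert a S) l' := by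
  have hal' : a ∉ (y :: x :: r) := fun h => hal (hr.mem_iff.2 h)
  have hu' : u ∉ (y :: x :: r) := fun h => hu (hr.mem_iff.2 h)
  have hau : a ≠ u := h1.1.ne
  have g := h.rot hr
  refine ⟨y :: a :: u :: x :: r, ?_, ?_, ?_, ?_, ?_⟩
  · have := g.nodup
    simp at this hal' hu' ⊢
    tauto
  · have := g.chain
    rw [Cycle.chain_coe_cons] at this ⊢
    simp at this ⊢
    tauto
  · have := g.len
    rw [Finset.card_insert_of_notMem ha]
    simp at this ⊢
    omega
  · intro v hv
    have := g.sub v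
    simp at hv this ⊢
    rcases hv with rfl | rfl | rfl | rfl | hv <;> tauto
  · intro v hv
    have := g.cov v
    simp at hv this ⊢
    tauto

theorem ins3 {V : Type*} [DecidableEq V] {H : SimpleGraph V} {A B S : Finset V} {l : List V}
    (h : GoodCyc H A B S l) {a u v y x : V} {r : List V} (ha : a ∉ S) (hal : a ∉ l)
    (hSB : y ∉ S)
    (hr : l ~r (y :: x :: r)) (hu : u ∉ l) (huB : u ∈ B) (hv : v ∉ l) (hvB : v ∈ B)
    (huv : u ≠ v)
    (h1 : bipRel H A B a u) (h2 : bipRel H A B u x) (h3 : bipRel H A B v a)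
    (h4 : bipRel H A B ((x :: r).getLast (by simp)) v) :
    ∃ l', GoodCyc H A B (insert a S) l' := by
  have hal' : a ∉ (y :: x :: r) := fun h => hal (hr.mem_iff.2 h)
  have hu' : u ∉ (y :: x :: r) := fun h => hu (hr.mem_iff.2 h)
  have hv' : v ∉ (y :: x :: r) := fun h => hv (hr.mem_iff.2 h)
  have hau : a ≠ u := h1.1.ne
  have hva : v ≠ a := h3.1.ne
  have g := h.rot hr
  refine ⟨v :: a :: u :: x :: r, ?_, ?_, ?_, ?_, ?_⟩
  · have := g.nodup
    simp at this hal' hu' hv' ⊢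
    tauto
  · have := g.chain
    rw [Cycle.chain_coe_cons] at this ⊢
    have e : a :: u :: x :: r ++ [v] = a :: u :: ((x :: r) ++ [v]) := rfl
    have e' : y :: (x :: r ++ [y]) = y :: (x :: (r ++ [y])) := rfl
    rw [e', List.isChain_cons_cons, ← List.cons_append, List.isChain_append] at this
    rw [e, List.isChain_cons_cons, List.isChain_cons_cons, List.cons_append,
      List.isChain_cons_cons, ← List.cons_append, List.isChain_append]
    refine ⟨h3, h1, h2, this.2.1, by simp, ?_⟩
    intro w hw z hz
    rw [List.getLast?_eq_some_getLast (by simp)] at hw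
    simp at hw hz
    subst hz
    rw [← hw]
    exact h4
  · have := g.len
    rw [Finset.card_insert_of_notMem ha]
    simp at this ⊢
    omega
  · intro v hv
    have := g.sub v
    simp at hv this ⊢
    rcases hv with rfl | rfl | rfl | rfl | hv <;> tauto
  · intro w hw
    have := g.cov w
    simp at hw this ⊢
    rcases hw with rfl | hw
    · tauto
    · have : w ≠ y := by rintro rfl; exact hSB hw
      tauto

theorem ins2 {V : Type*} [DecidableEq V] {H : SimpleGraph V} {A B S : Finset V} {l : List V}
    (hd : Disjoint A B)
    (h : GoodCyc H A B S l) {a w y x y' x' : V} {r r' : List V} (ha : a ∉ S) (hal : a ∉ l)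
    (hyB : y ∈ B) (hyB' : y' ∈ B) (hyx : bipRel H A B y x) (hyx' : bipRel H A B y' x')
    (hne : y ≠ y')
    (hr : l ~r (y :: x :: r)) (hr' : l ~r (y' :: x' :: r')) (hw : w ∉ l) (hwB : w ∈ B)
    (haw : a ≠ w)
    (h1 : bipRel H A B a y) (h2 : bipRel H A B a y') (h3 : bipRel H A B w x)
    (h4 : bipRel H A B w x') :
    ∃ l', GoodCyc H A B (insert a S) l' := by
  have hxA : x ∈ A := by
    rcases hyx.2 with h | h
    · exact absurd hyB (Finset.disjoint_left.1 hd h.1)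
    · exact h.2
  have hxA' : x' ∈ A := by
    rcases hyx'.2 with h | h
    · exact absurd hyB' (Finset.disjoint_left.1 hd h.1)
    · exact h.2
  have hAB := Finset.disjoint_left.1 hd
  -- decomposition
  obtain ⟨l1, l2, hl⟩ : ∃ l1 l2, l ~r (y :: x :: (l1 ++ y' :: x' :: l2)) := by
    obtain ⟨k, hk, e⟩ := List.isRotated_iff_mod.1 (hr.symm.trans hr')
    rw [List.rotate_eq_drop_append_take hk] at e
    obtain ⟨s, t, hst, hs, ht⟩ : ∃ s t, y :: x :: r = s ++ t ∧
        s = List.take k (y :: x :: r) ∧ t = List.drop k (y :: x :: r) :=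
      ⟨_, _, (List.take_append_drop k _).symm, rfl, rfl⟩
    rw [← hs, ← ht] at e
    clear hs ht hk
    have hne2 : x ≠ y' := by rintro rfl; exact hAB hxA hyB'
    have hne3 : x' ≠ y := by rintro rfl; exact hAB hxA' hyB
    rcases s with _ | ⟨s0, _ | ⟨s1, s⟩⟩
    · simp at hst e
      rw [← hst] at e
      simp at e
      exact absurd e.1 hne
    · simp at hst
      obtain ⟨rfl, rfl⟩ := hst
      simp at e
      exact absurd e.1 hne2
    · simp at hst
      obtain ⟨rfl, rfl, rfl⟩ := hst
      rcases t with _ | ⟨t0, _ | ⟨t1, t⟩⟩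
      · simp at e
        exact absurd e.1 hne
      · simp at e
        exact absurd e.2.1.symm hne3
      · simp at e
        obtain ⟨rfl, rfl, _⟩ := e
        exact ⟨s, t, hr⟩
  have g := h.rot hl
  have hal' : a ∉ _ := fun h => hal (hl.mem_iff.2 h)
  have hw' : w ∉ _ := fun h => hw (hl.mem_iff.2 h)
  have hp : (a :: ((x :: (l1 ++ [y'])).reverse ++ (w :: x' :: l2 ++ [y]))).Perm
      (a :: w :: (y :: x :: (l1 ++ y' :: x' :: l2))) := by
    rw [List.perm_iff_count]
    intro v
    simp [List.count_cons, List.count_append]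
    omega
  refine ⟨a :: ((x :: (l1 ++ [y'])).reverse ++ (w :: x' :: l2 ++ [y])), ?_, ?_, ?_, ?_, ?_⟩
  · rw [hp.nodup_iff, List.nodup_cons, List.nodup_cons]
    refine ⟨?_, hw', g.nodup⟩
    rw [List.mem_cons]
    tauto
  · have := g.chain
    rw [Cycle.chain_coe_cons] at this ⊢
    have e : y :: (x :: (l1 ++ y' :: x' :: l2) ++ [y]) =
      y :: (x :: (l1 ++ y' :: x' :: (l2 ++ [y]))) := by simp
    rw [e, List.isChain_cons_cons, List.isChain_cons_append_cons_cons] at this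
    have e2 : a :: ((x :: (l1 ++ [y'])).reverse ++ (w :: x' :: l2 ++ [y]) ++ [a]) =
      (a :: y' :: l1.reverse) ++ x :: w :: x' :: (l2 ++ y :: a :: []) := by simp
    rw [e2, List.isChain_append_cons_cons, List.isChain_cons_cons]
    have e3 : (a :: y' :: l1.reverse) ++ [x] = a :: (y' :: (l1.reverse ++ [x])) := rfl
    rw [e3, List.isChain_cons_cons, List.isChain_cons_append_cons_cons]
    have hrev : List.IsChain (bipRel H A B) (x :: (l1 ++ [y'])).reverse := by
      rw [List.isChain_reverse]
      exact this.2.1.imp (fun _ _ h => bipRel_symm h)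
    simp at hrev
    refine ⟨⟨h2, by simpa using hrev⟩, bipRel_symm h3, h4, by simpa using this.2.2.2,
      bipRel_symm h1, by simp⟩
  · have := g.len
    rw [hp.length_eq, Finset.card_insert_of_notMem ha, List.length_cons, List.length_cons, this]
    omega
  · intro v hv
    rw [hp.mem_iff, List.mem_cons, List.mem_cons] at hv
    have := g.sub v
    rw [Finset.mem_insert]
    rcases hv with rfl | rfl | hv <;> tauto
  · intro v hv
    rw [hp.mem_iff, List.mem_cons, List.mem_cons]
    have := g.cov v
    rw [Finset.mem_insert] at hv
    tauto

theorem nbr_out {V : Type*} [DecidableEq V] {H : SimpleGraph V} {A B S : Finset V} {p : ℕ}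
    {l : List V} (h : GoodCyc H A B S l) (hSA : S ⊆ A) (hd : Disjoint A B)
    (T : Finset V) (hT : T ⊆ B) (hcard : p + 3 ≤ T.card) :
    p + 3 ≤ (T \ l.toFinset).card + S.card := by
  have h1 := h.card_out hSA hd
  have h2 := Finset.card_sdiff_add_card_inter T l.toFinset
  have h3 : (T ∩ l.toFinset).card ≤ (B ∩ l.toFinset).card :=
    Finset.card_le_card (Finset.inter_subset_inter_right hT)
  omega

open Classical in
theorem cyc_step {V : Type*} {H : SimpleGraph V} {A B S : Finset V} {p : ℕ}
    (hd : Disjoint A B) (hB : B.card = 2 * p + 2)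
    (hdeg : ∀ a ∈ A, p + 3 ≤ (B.filter (H.Adj a)).card) {l : List V}
    (h : GoodCyc H A B S l) (hSA : S ⊆ A) (hS : S.Nonempty) (hSp : S.card ≤ p)
    {a : V} (haA : a ∈ A) (ha : a ∉ S) : ∃ l', GoodCyc H A B (insert a S) l' := by
  have hAB := Finset.disjoint_left.1 hd
  have hal : a ∉ l := fun hh => by
    rcases h.sub a hh with h' | h'
    · exact ha h'
    · exact hAB haA h'
  set N : V → Finset V := fun v => B.filter (H.Adj v) with hN
  set U := B \ l.toFinset with hU
  have hUc : U.card + S.card = 2 * p + 2 := by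
    have h2 : U.card + (B ∩ l.toFinset).card = B.card :=
      Finset.card_sdiff_add_card_inter B l.toFinset
    rw [h.card_out hSA hd] at h2
    omega
  have hbip : ∀ {z u}, z ∈ A → u ∈ N z → bipRel H A B z u := by
    intro z u hz hu
    simp [hN] at hu
    exact ⟨hu.2, Or.inl ⟨hz, hu.1⟩⟩
  have hout : ∀ z ∈ A, p + 3 ≤ (N z \ l.toFinset).card + S.card := fun z hz =>
    nbr_out h hSA hd _ (Finset.filter_subset _ _) (hdeg z hz)
  have hmem : ∀ {y x}, y ∈ B → bipRel H A B y x → x ∈ A := by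
    intro y x hy hyx
    rcases hyx.2 with h | h
    · exact absurd hy (hAB h.1)
    · exact h.2
  have hSpos := hS.card_pos
  by_cases hcase : ∃ y0 ∈ N a, y0 ∈ l
  · obtain ⟨y0, hy0N, hy0l⟩ := hcase
    have hsucc : ∀ y, ∃ x, y ∈ l → ∃ r, l ~r (y :: x :: r) ∧ bipRel H A B y x := by
      intro y
      by_cases hy : y ∈ l
      · obtain ⟨x, r, h1, h2⟩ := h.succ hy
        exact ⟨x, fun _ => ⟨r, h1, h2⟩⟩
      · exact ⟨y, fun h => absurd h hy⟩
    choose sc hsc using hsucc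
    have hBN : ∀ {y z}, y ∈ N z → y ∈ B := by
      intro y z hy; exact (Finset.mem_filter.1 hy).1
    have hscA : ∀ y ∈ N a, y ∈ l → sc y ∈ A := by
      intro y hy hyl
      obtain ⟨r, _, h2⟩ := hsc y hyl
      exact hmem (hBN hy) h2
    -- the choice map
    have hphi : ∀ y, ∃ u, y ∈ N a → u ∈ U ∧ (y ∉ l → u = y) ∧ (y ∈ l → u ∈ N (sc y)) := by
      intro y
      by_cases hyN : y ∈ N a
      · by_cases hyl : y ∈ l
        · have := hout _ (hscA y hyN hyl)
          have : 0 < (N (sc y) \ l.toFinset).card := by omega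
          obtain ⟨u, hu⟩ := Finset.card_pos.1 this
          rw [Finset.mem_sdiff] at hu
          exact ⟨u, fun _ => ⟨Finset.mem_sdiff.2 ⟨hBN hu.1, hu.2⟩, fun h => absurd hyl h,
            fun _ => hu.1⟩⟩
        · exact ⟨y, fun _ => ⟨Finset.mem_sdiff.2 ⟨hBN hyN, by simpa using hyl⟩, fun _ => rfl,
            fun h => absurd h hyl⟩⟩
      · exact ⟨y, fun h => absurd h hyN⟩
    choose phi hphi using hphi
    have hUm : ∀ {u}, u ∈ U → u ∈ B ∧ u ∉ l := by
      intro u hu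
      simpa [hU] using hu
    -- collision of two elements
    have coll : ∀ y ∈ N a, ∀ y' ∈ N a, y ≠ y' → y ∈ l → ∀ u ∈ U, u ∈ N (sc y) →
        (y' ∉ l → u = y') → (y' ∈ l → u ∈ N (sc y')) →
        ∃ l', GoodCyc H A B (insert a S) l' := by
      intro y hy y' hy' hne hyl u huU hu c1 c2
      obtain ⟨r, hr, hyx⟩ := hsc y hyl
      obtain ⟨huB, hul⟩ := hUm huU
      have hxA := hscA y hy hyl
      by_cases hyl' : y' ∈ l
      · obtain ⟨r', hr', hyx'⟩ := hsc y' hyl'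
        have hxA' := hscA y' hy' hyl'
        exact ins2 hd h ha hal (hBN hy) (hBN hy') hyx hyx' hne hr hr' hul huB
          (by rintro rfl; exact hAB haA huB) (hbip haA hy) (hbip haA hy')
          (bipRel_symm (hbip hxA hu)) (bipRel_symm (hbip hxA' (c2 hyl')))
      · have := c1 hyl'
        subst this
        exact ins1 h ha hal hr (bipRel_symm (hbip haA hy)) hul huB (hbip haA hy')
          (bipRel_symm (hbip hxA hu))
    have hF : p + 3 ≤ (N (sc y0) \ l.toFinset).card + S.card := hout _ (hscA y0 hy0N hy0l)
    have hFU : N (sc y0) \ l.toFinset ⊆ U :=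
      Finset.sdiff_subset_sdiff (Finset.filter_subset _ _) le_rfl
    have hlt : (U \ (N (sc y0) \ l.toFinset)).card < ((N a).erase y0).card := by
      rw [Finset.card_sdiff_of_subset hFU, Finset.card_erase_of_mem hy0N]
      have : p + 3 ≤ (N a).card := hdeg a haA
      omega
    by_cases hin : ∃ y ∈ (N a).erase y0, phi y ∈ N (sc y0)
    · obtain ⟨y, hy, hyF⟩ := hin
      rw [Finset.mem_erase] at hy
      obtain ⟨p1, p2, p3⟩ := hphi y hy.2
      exact coll y0 hy0N y hy.2 hy.1.symm hy0l (phi y) p1 hyF p2 p3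
    · push Not at hin
      obtain ⟨y, hy, y', hy', hne, heq⟩ :=
        Finset.exists_ne_map_eq_of_card_lt_of_maps_to (f := phi) hlt (by
          intro y hy
          have hy := Finset.mem_coe.1 hy
          have := hphi y (Finset.mem_of_mem_erase hy)
          exact Finset.mem_coe.2 (Finset.mem_sdiff.2
            ⟨this.1, fun h => hin y hy (Finset.mem_sdiff.1 h).1⟩))
      have hyN := Finset.mem_of_mem_erase hy
      have hyN' := Finset.mem_of_mem_erase hy'
      obtain ⟨p1, p2, p3⟩ := hphi y hyN
      obtain ⟨p1', p2', p3'⟩ := hphi y' hyN'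
      by_cases hyl : y ∈ l
      · exact coll y hyN y' hyN' hne hyl (phi y) p1 (p3 hyl) (heq ▸ p2') (heq ▸ p3')
      · by_cases hyl' : y' ∈ l
        · exact coll y' hyN' y hyN hne.symm hyl' (phi y) p1 (heq ▸ p3' hyl') p2 p3
        · exact absurd ((p2 hyl).symm.trans (heq.trans (p2' hyl'))) hne
  · push Not at hcase
    have hNU : N a ⊆ U := by
      intro y hy
      simp only [hU, Finset.mem_sdiff]
      exact ⟨(Finset.mem_filter.1 hy).1, by simpa using hcase y hy⟩
    have hcommon : ∀ x ∈ A, 4 ≤ (N a ∩ (N x \ l.toFinset)).card := by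
      intro x hx
      have h1 := Finset.card_union_add_card_inter (N a) (N x \ l.toFinset)
      have h2 : (N a ∪ (N x \ l.toFinset)).card ≤ U.card :=
        Finset.card_le_card (Finset.union_subset hNU
          (Finset.sdiff_subset_sdiff (Finset.filter_subset _ _) le_rfl))
      have := hout x hx
      have : p + 3 ≤ (N a).card := hdeg a haA
      omega
    have : 0 < (B ∩ l.toFinset).card := by rw [h.card_out hSA hd]; exact hSpos
    obtain ⟨y, hy⟩ := Finset.card_pos.1 this
    simp at hy
    obtain ⟨x, r, hr, hyx⟩ := h.succ hy.2
    have hxA := hmem hy.1 hyx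
    have g := h.rot hr
    have hlast : bipRel H A B ((x :: r).getLast (by simp)) y := by
      have := g.chain
      rw [Cycle.chain_coe_cons] at this
      have e' : y :: (x :: r ++ [y]) = y :: (x :: (r ++ [y])) := rfl
      rw [e', List.isChain_cons_cons, ← List.cons_append, List.isChain_append] at this
      exact this.2.2.2 _ (by rw [List.getLast?_eq_some_getLast (by simp)]; simp) _ (by simp)
    have hlA := hmem hy.1 (bipRel_symm hlast)
    obtain ⟨u, hu⟩ := Finset.card_pos.1 (lt_of_lt_of_le (by norm_num) (hcommon x hxA))
    have : 0 < ((N a ∩ (N ((x :: r).getLast (by simp)) \ l.toFinset)).erase u).card := by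
      have := hcommon _ hlA
      have := Finset.pred_card_le_card_erase (a := u)
        (s := N a ∩ (N ((x :: r).getLast (by simp)) \ l.toFinset))
      omega
    obtain ⟨v, hv⟩ := Finset.card_pos.1 this
    rw [Finset.mem_erase, Finset.mem_inter, Finset.mem_sdiff] at hv
    rw [Finset.mem_inter, Finset.mem_sdiff] at hu
    exact ins3 h ha hal (fun hyS => hAB (hSA hyS) hy.1) hr (by simpa using hu.2.2)
      (Finset.mem_filter.1 hu.1).1 (by simpa using hv.2.2.2) (Finset.mem_filter.1 hv.2.1).1
      hv.1.symm (hbip haA hu.1) (bipRel_symm (hbip hxA hu.2.1)) (bipRel_symm (hbip haA hv.2.1))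
      (hbip hlA hv.2.2.1)

open Classical in
theorem exists_cyc {V : Type*} {H : SimpleGraph V} {A B : Finset V} {p : ℕ}
    (hd : Disjoint A B) (hB : B.card = 2 * p + 2)
    (hdeg : ∀ a ∈ A, p + 3 ≤ (B.filter (H.Adj a)).card) (S : Finset V) (hS : S.Nonempty) :
    S ⊆ A → S.card ≤ p + 1 → ∃ l, GoodCyc H A B S l := by
  induction hS using Finset.Nonempty.cons_induction with
  | singleton a =>
    intro hSA _
    have haA : a ∈ A := hSA (by simp)
    have := hdeg a haA
    obtain ⟨u, hu⟩ := Finset.card_pos.1 (show 0 < (B.filter (H.Adj a)).card by omega)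
    simp at hu
    have hb : bipRel H A B a u := ⟨hu.2, Or.inl ⟨haA, hu.1⟩⟩
    refine ⟨[a, u], by simpa using hu.2.ne, ?_, by simp, ?_, by simp⟩
    · rw [Cycle.chain_coe_cons]
      simpa using ⟨hb, bipRel_symm hb⟩
    · simp [hu.1]
  | cons a S ha hS ih =>
    intro hSA hc
    rw [Finset.card_cons] at hc
    have hSA' : S ⊆ A := fun v hv => hSA (by simp [hv])
    obtain ⟨l, hl⟩ := ih hSA' (by omega)
    rw [Finset.cons_eq_insert]
    exact cyc_step hd hB hdeg hl hSA' hS (by omega) (hSA (by simp)) ha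

theorem copy_of_lists {V : Type*} {H : SimpleGraph V} {c n m : ℕ} (P L1 L2 : List V)
    (hP : P ≠ []) (hPl : P.length = c) (h1l : L1.length = n) (h2l : L2.length = m)
    (hch : P.IsChain H.Adj) (hnd : (P ++ (L1 ++ L2)).Nodup)
    (h1 : ∀ v ∈ L1, H.Adj (P.head hP) v) (h2 : ∀ v ∈ L2, H.Adj (P.getLast hP) v) :
    HasCopy (LinkedDoubleStar c n m) H := by
  subst hPl h1l h2l
  rw [List.nodup_append, List.nodup_append] at hnd
  obtain ⟨n0, ⟨n1, n2, n12⟩, n3⟩ := hnd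
  let f : Fin P.length ⊕ Fin L1.length ⊕ Fin L2.length → V :=
    Sum.elim (fun i => P[i]) (Sum.elim (fun i => L1[i]) (fun i => L2[i]))
  have key : ∀ a b, ldsRel P.length L1.length L2.length a b → H.Adj (f a) (f b) := by
    rintro (i | i | i) (j | j | j) h <;> simp only [ldsRel] at h
    · have hj := j.2
      have := List.isChain_iff_getElem.1 hch i (by omega)
      simp only [f, Sum.elim_inl]
      have e : P[j] = P[(i : ℕ) + 1] :=
        getElem_congr_idx (c := P) (i := (j : ℕ)) (j := (i : ℕ) + 1) h
      rw [e]
      exact this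
    · have := h1 L1[j] (by simp)
      rw [List.head_eq_getElem] at this
      simp only [f, Sum.elim_inl, Sum.elim_inr]
      convert this using 1
      simp [h]
    · have := h2 L2[j] (by simp)
      rw [List.getLast_eq_getElem] at this
      simp only [f, Sum.elim_inl, Sum.elim_inr]
      convert this using 1
      simp [h]
  refine ⟨f, ?_, ?_⟩
  · have m1 : ∀ i : Fin L1.length, L1[i] ∈ L1 ++ L2 := fun i => by simp
    have m2 : ∀ i : Fin L2.length, L2[i] ∈ L1 ++ L2 := fun i => by simp
    rintro (i | i | i) (j | j | j) h <;> simp only [f, Sum.elim_inl, Sum.elim_inr] at h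
    · have := (List.Nodup.getElem_inj_iff n0).1 h
      rw [Fin.ext this]
    · exact absurd h (n3 _ (by simp) _ (m1 j))
    · exact absurd h (n3 _ (by simp) _ (m2 j))
    · exact absurd h.symm (n3 _ (by simp) _ (m1 i))
    · have := (List.Nodup.getElem_inj_iff n1).1 h
      rw [Fin.ext this]
    · exact absurd h (n12 _ (by simp) _ (by simp))
    · exact absurd h.symm (n3 _ (by simp) _ (m2 i))
    · exact absurd h.symm (n12 _ (by simp) _ (by simp))
    · have := (List.Nodup.getElem_inj_iff n2).1 h
      rw [Fin.ext this]
  · intro a b hab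
    rw [LinkedDoubleStar, SimpleGraph.fromRel_adj] at hab
    rcases hab.2 with h | h
    · exact key a b h
    · exact (key b a h).symm

open Classical in
theorem finish {V : Type*} {H : SimpleGraph V} {c n : ℕ} (P : List V)
    (hP : P ≠ []) (hPl : P.length = c) (hnd : P.Nodup) (hch : P.IsChain H.Adj) (N1 : Finset V)
    (hN : n + 1 ≤ N1.card) (hN1 : ∀ v ∈ N1, H.Adj (P.head hP) v) (hN2 : ∀ v ∈ N1, v ∉ P)
    (x y : V) (hxN : x ∉ N1) (hxy : x ≠ y) (hx : x ∉ P) (hy : y ∉ P)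
    (hex : H.Adj (P.getLast hP) x) (hey : H.Adj (P.getLast hP) y) :
    HasCopy (LinkedDoubleStar c n 2) H := by
  have : n ≤ (N1.erase y).card := by
    have := Finset.pred_card_le_card_erase (a := y) (s := N1)
    omega
  obtain ⟨T, hT, hTc⟩ := Finset.exists_subset_card_eq this
  have hTN : ∀ v ∈ T, v ∈ N1 := fun v hv => Finset.mem_of_mem_erase (hT hv)
  have hTy : y ∉ T := fun hv => Finset.ne_of_mem_erase (hT hv) rfl
  have hTx : x ∉ T := fun hv => hxN (hTN _ hv)
  refine copy_of_lists P T.toList [x, y] hP hPl (by simp [hTc]) rfl hch ?_ ?_ ?_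
  · rw [List.nodup_append, List.nodup_append]
    refine ⟨hnd, ⟨T.nodup_toList, by simpa using hxy, ?_⟩, ?_⟩
    · intro v hv w hw
      simp at hv hw
      rintro rfl
      rcases hw with rfl | rfl <;> tauto
    · intro v hv w hw
      simp at hw
      rintro rfl
      rcases hw with hw | rfl | rfl
      · exact hN2 _ (hTN _ hw) hv
      · exact hx hv
      · exact hy hv
  · intro v hv
    exact hN1 v (hTN v (by simpa using hv))
  · intro v hv
    simp at hv
    rcases hv with rfl | rfl <;> assumption

theorem cycleMap_of_list {V : Type*} {H : SimpleGraph V} {k : ℕ} (l : List V)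
    (hl : l.length = k + 1) (hnd : l.Nodup) (hch : (l : Cycle V).Chain H.Adj) :
    ∃ f : ZMod (k + 1) → V, IsCycleMap H f ∧ Set.range f = {v | v ∈ l} := by
  refine ⟨fun i : Fin (k + 1) => l[(i : ℕ)], ⟨?_, ?_⟩, ?_⟩
  · intro i j h
    have := (List.Nodup.getElem_inj_iff hnd).1 h
    exact Fin.ext this
  · intro (i : Fin (k + 1))
    rcases l with _ | ⟨a, l⟩
    · simp at hl
    rw [Cycle.chain_coe_cons] at hch
    have hi := i.2
    simp only [List.length_cons, Nat.add_right_cancel_iff] at hl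
    have h1 : H.Adj ((a :: l ++ [a])[(i : ℕ)]'(by simp; omega))
        ((a :: l ++ [a])[(i : ℕ) + 1]'(by simp; omega)) :=
      List.isChain_iff_getElem.1 hch i (by simp; omega)
    have e1 : (a :: l ++ [a])[(i : ℕ)]'(by simp; omega) = (a :: l)[(i : ℕ)]'(by simp; omega) :=
      List.getElem_append_left _
    change H.Adj ((a :: l)[(i : ℕ)]'(by simp; omega))
      ((a :: l)[((i + 1 : Fin (k + 1)) : ℕ)]'(by have := (i + 1 : Fin (k+1)).2; simp; omega))
    rw [e1] at h1
    by_cases hik : (i : ℕ) = k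
    · have e2 : i + 1 = (0 : Fin (k + 1)) := by
        have : i = Fin.last k := Fin.ext hik
        rw [this]; simp
      have e3 : (a :: l ++ [a])[(i : ℕ) + 1]'(by simp; omega) = a := by
        simp [hik, hl]
      rw [e3] at h1
      have e4 : ((i + 1 : Fin (k + 1)) : ℕ) = 0 := by rw [e2]; rfl
      convert h1 using 1
      exact getElem_congr_idx (c := a :: l) (j := 0) e4
    · have e2 : ((i + 1 : Fin (k + 1)) : ℕ) = i + 1 :=
        Fin.val_add_one_of_lt (Fin.lt_def.2 (by simp; omega))
      have e3 : (a :: l ++ [a])[(i : ℕ) + 1]'(by simp; omega) =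
          (a :: l)[(i : ℕ) + 1]'(by simp; omega) :=
        List.getElem_append_left _
      rw [e3] at h1
      convert h1 using 1
      exact getElem_congr_idx (c := a :: l) e2
  · ext v
    constructor
    · rintro ⟨i, rfl⟩
      simp
    · intro hv
      obtain ⟨i, hi, rfl⟩ := List.getElem_of_mem hv
      exact ⟨(⟨i, by omega⟩ : Fin (k + 1)), rfl⟩

open Classical in
theorem stat_bound {V : Type*} [Fintype V] {H : SimpleGraph V} {C : Finset V} {p : ℕ}
    (hp : 1 ≤ p) (hC : C.card = 2 * p + 2) (hs : cycStat H (C : Set V) ≤ p - 1) {z : V}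
    (hz : z ∉ C) : p + 3 ≤ (C.filter (Hᶜ.Adj z)).card := by
  have h1 : ({w ∈ (C : Set V) | H.Adj z w}).ncard ≤ p - 1 := by
    have hb : BddAbove ((fun z => ({w ∈ (C : Set V) | H.Adj z w}).ncard) '' (C : Set V)ᶜ) :=
      (Set.toFinite _).bddAbove
    exact le_trans (le_csSup hb ⟨z, by simpa using hz, rfl⟩) hs
  have h2 : {w ∈ (C : Set V) | H.Adj z w} = ((C.filter (H.Adj z) : Finset V) : Set V) := by
    ext; simp
  rw [h2, Set.ncard_coe_finset] at h1
  have h3 := Finset.card_filter_add_card_filter_not (s := C) (H.Adj z)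
  have h4 : C.filter (fun w => ¬ H.Adj z w) = C.filter (Hᶜ.Adj z) := by
    apply Finset.filter_congr
    intro w hw
    rw [SimpleGraph.compl_adj]
    have : z ≠ w := by rintro rfl; exact hz hw
    tauto
  rw [h4] at h3
  omega

/-- A cycle through `S`, together with an outside vertex `z`. -/
theorem red_case {V : Type*} [DecidableEq V] {H : SimpleGraph V} {A B S : Finset V}
    {p n : ℕ} (hp : 1 ≤ p) (hd : Disjoint A B)
    (hdeg : ∀ a ∈ A, ∃ T ⊆ B, p + 3 ≤ T.card ∧ ∀ v ∈ T, H.Adj a v) {l : List V}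
    (h : GoodCyc H A B S l) (hSA : S ⊆ A) (hSp : S.card = p + 1) {z q : V}
    (hzA : z ∈ A) (hz : z ∉ l) (hq : q ∈ l) (hqB : q ∈ B) (hzq : H.Adj z q) (N1 : Finset V)
    (hN : n + 1 ≤ N1.card) (hN1 : ∀ v ∈ N1, H.Adj z v) (hN2 : ∀ v ∈ N1, v ∉ l) :
    HasCopy (LinkedDoubleStar (2 * p + 1) n 2) H := by
  have hAB := Finset.disjoint_left.1 hd
  have hsw : ∀ {u v}, bipRel H A B u v → (v ∈ B → u ∈ A) ∧ (v ∈ A → u ∈ B) := by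
    intro u v huv
    rcases huv.2 with ⟨h1, h2⟩ | ⟨h1, h2⟩
    · exact ⟨fun _ => h1, fun h => absurd h2 (hAB h)⟩
    · exact ⟨fun h => absurd h (hAB h2), fun _ => h1⟩
  obtain ⟨r, hr⟩ := rot_to hq
  have g := h.rot hr
  have hlen := g.len
  simp [hSp] at hlen
  obtain ⟨r, e, rfl⟩ : ∃ r' e, r = r' ++ [e] :=
    ⟨_, _, (List.dropLast_append_getLast (List.ne_nil_of_length_pos (by omega))).symm⟩
  simp at hlen
  obtain ⟨r, x, rfl⟩ : ∃ r' e, r = r' ++ [e] :=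
    ⟨_, _, (List.dropLast_append_getLast (List.ne_nil_of_length_pos (by omega))).symm⟩
  simp at hlen
  obtain ⟨r, b, rfl⟩ : ∃ r' e, r = r' ++ [e] :=
    ⟨_, _, (List.dropLast_append_getLast (List.ne_nil_of_length_pos (by omega))).symm⟩
  simp at hlen
  have hch := g.chain
  rw [Cycle.chain_coe_cons] at hch
  have e1 : q :: (r ++ [b] ++ [x] ++ [e] ++ [q]) = q :: (r ++ b :: x :: [e, q]) := by simp
  rw [e1, List.isChain_cons_append_cons_cons] at hch
  obtain ⟨c1, c2, c3⟩ := hch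
  simp at c3
  have hbA : b ∈ A := (hsw c2).1 ((hsw c3.1).2 ((hsw c3.2).1 hqB))
  have hxB := (hsw c3.1).2 ((hsw c3.2).1 hqB)
  obtain ⟨T, hTB, hTc, hT⟩ := hdeg b hbA
  have hy := nbr_out h hSA hd T hTB hTc
  obtain ⟨y, hy⟩ := Finset.card_pos.1 (show 0 < (T \ l.toFinset).card by omega)
  simp at hy
  have hml : ∀ v, v ∈ l ↔ v ∈ (q :: (r ++ [b] ++ [x] ++ [e])) := fun v => hr.mem_iff
  have hnd := g.nodup
  have hxl : x ∈ l := by rw [hml]; simp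
  have hPl : ∀ v ∈ q :: (r ++ [b]), v ∈ l := by
    intro v hv
    rw [hml]
    simp at hv ⊢
    tauto
  have hxP : x ∉ q :: (r ++ [b]) := by
    have e2 : q :: (r ++ [b] ++ [x] ++ [e]) = (q :: (r ++ [b])) ++ [x, e] := by simp
    rw [e2, List.nodup_append] at hnd
    exact fun hh => hnd.2.2 x hh x (by simp) rfl
  have hlast : (z :: q :: (r ++ [b])).getLast (by simp) = b := by simp
  refine finish (z :: q :: (r ++ [b])) (by simp) (by simp; omega) ?_ ?_ N1 hN ?_ ?_ x y
    (fun hx => hN2 x hx hxl) (by rintro rfl; exact hy.2 hxl) ?_ ?_ ?_ ?_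
  · rw [List.nodup_cons]
    refine ⟨fun hh => hz (hPl z hh), ?_⟩
    have e2 : q :: (r ++ [b] ++ [x] ++ [e]) = (q :: (r ++ [b])) ++ [x, e] := by simp
    rw [e2, List.nodup_append] at hnd
    exact hnd.1
  · rw [List.isChain_cons_cons]
    exact ⟨hzq, c1.imp fun _ _ h => h.1⟩
  · simpa using hN1
  · intro v hv hvP
    rw [List.mem_cons] at hvP
    rcases hvP with rfl | hvP
    · exact (hN1 _ hv).ne rfl
    · exact hN2 v hv (hPl v hvP)
  · rw [List.mem_cons]
    rintro (rfl | hh)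
    · exact hz hxl
    · exact hxP hh
  · rw [List.mem_cons]
    rintro (rfl | hh)
    · exact hAB hzA (hTB hy.1)
    · exact hy.2 (hPl y hh)
  · rw [hlast]; exact c2.1
  · rw [hlast]; exact hT y hy.1

/-- A cycle through `S`, with a vertex `z ∈ S` having many neighbours outside. -/
theorem blue_case {V : Type*} [DecidableEq V] {H : SimpleGraph V} {A B S : Finset V}
    {p n : ℕ} (hp : 1 ≤ p) (hd : Disjoint A B)
    (hdeg : ∀ a ∈ A, ∃ T ⊆ B, p + 3 ≤ T.card ∧ ∀ v ∈ T, H.Adj a v) {l : List V}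
    (h : GoodCyc H A B S l) (hSA : S ⊆ A) (hSp : S.card = p + 1) {z : V}
    (hz : z ∈ S) (N1 : Finset V)
    (hN : n + 1 ≤ N1.card) (hN1 : ∀ v ∈ N1, H.Adj z v) (hN2 : ∀ v ∈ N1, v ∉ l) :
    HasCopy (LinkedDoubleStar (2 * p + 1) n 2) H := by
  have hAB := Finset.disjoint_left.1 hd
  have hsw : ∀ {u v}, bipRel H A B u v → (v ∈ B → u ∈ A) ∧ (v ∈ A → u ∈ B) := by
    intro u v huv
    rcases huv.2 with ⟨h1, h2⟩ | ⟨h1, h2⟩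
    · exact ⟨fun _ => h1, fun h => absurd h2 (hAB h)⟩
    · exact ⟨fun h => absurd h (hAB h2), fun _ => h1⟩
  obtain ⟨r, hr⟩ := rot_to (h.cov z hz)
  have g := h.rot hr
  have hlen := g.len
  simp [hSp] at hlen
  obtain ⟨r, x, rfl⟩ : ∃ r' e, r = r' ++ [e] :=
    ⟨_, _, (List.dropLast_append_getLast (List.ne_nil_of_length_pos (by omega))).symm⟩
  simp at hlen
  obtain ⟨r, b, rfl⟩ : ∃ r' e, r = r' ++ [e] :=
    ⟨_, _, (List.dropLast_append_getLast (List.ne_nil_of_length_pos (by omega))).symm⟩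
  simp at hlen
  have hch := g.chain
  rw [Cycle.chain_coe_cons] at hch
  have e1 : z :: (r ++ [b] ++ [x] ++ [z]) = z :: (r ++ b :: x :: [z]) := by simp
  rw [e1, List.isChain_cons_append_cons_cons] at hch
  obtain ⟨c1, c2, c3⟩ := hch
  simp at c3
  have hxB := (hsw c3).2 (hSA hz)
  have hbA : b ∈ A := (hsw c2).1 hxB
  obtain ⟨T, hTB, hTc, hT⟩ := hdeg b hbA
  have hy := nbr_out h hSA hd T hTB hTc
  obtain ⟨y, hy⟩ := Finset.card_pos.1 (show 0 < (T \ l.toFinset).card by omega)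
  simp at hy
  have hml : ∀ v, v ∈ l ↔ v ∈ (z :: (r ++ [b] ++ [x])) := fun v => hr.mem_iff
  have hxl : x ∈ l := by rw [hml]; simp
  have hPl : ∀ v ∈ z :: (r ++ [b]), v ∈ l := by
    intro v hv
    rw [hml]
    simp at hv ⊢
    tauto
  have hnd := g.nodup
  have e2 : z :: (r ++ [b] ++ [x]) = (z :: (r ++ [b])) ++ [x] := by simp
  rw [e2, List.nodup_append] at hnd
  have hlast : (z :: (r ++ [b])).getLast (by simp) = b := by simp
  refine finish (z :: (r ++ [b])) (by simp) (by simp; omega) hnd.1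
    (c1.imp fun _ _ h => h.1) N1 hN (by simpa using hN1) (fun v hv hvP => hN2 v hv (hPl v hvP))
    x y (fun hx => hN2 x hx hxl) (by rintro rfl; exact hy.2 hxl)
    (fun hh => hnd.2.2 x hh x (by simp) rfl) (fun hh => hy.2 (hPl y hh)) ?_ ?_
  · rw [hlast]; exact c2.1
  · rw [hlast]; exact hT y hy.1

/-- on `n + 3p + 3` vertices, if `Q` is a blue cycle on `2p+2`
vertices with `s(Q)` maximal among all monochromatic cycles on `2p+2` vertices
and `s(Q) ≤ p − 1`, then there is a monochromatic `S_c(n,2)`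
(red edges form `G`, blue edges form `Gᶜ`). -/
theorem lds_sQ_small (p n : ℕ) (hp : 1 ≤ p) (hn2 : 2 ≤ n) (hnp : n ≤ p)
    {V : Type*} [Fintype V] (hV : Fintype.card V = n + 3 * p + 3)
    (G : SimpleGraph V) (q : ZMod (2 * p + 2) → V) (hq : IsCycleMap Gᶜ q)
    (hmaxR : ∀ f : ZMod (2 * p + 2) → V, IsCycleMap G f →
      cycStat G (Set.range f) ≤ cycStat Gᶜ (Set.range q))
    (hmaxB : ∀ f : ZMod (2 * p + 2) → V, IsCycleMap Gᶜ f →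
      cycStat Gᶜ (Set.range f) ≤ cycStat Gᶜ (Set.range q))
    (hs : cycStat Gᶜ (Set.range q) ≤ p - 1) :
    HasMonoLDS G (2 * p + 1) n 2 := by
  classical
  set Q : Finset V := Finset.univ.image q with hQ
  have hQr : (Q : Set V) = Set.range q := by simp [hQ]
  have hQc : Q.card = 2 * p + 2 := by
    rw [hQ, Finset.card_image_of_injective _ hq.1, Finset.card_univ, ZMod.card]
  have hdQ : ∀ a ∈ Qᶜ, p + 3 ≤ (Q.filter (G.Adj a)).card := by
    intro a ha
    have := stat_bound (H := Gᶜ) hp hQc (by rw [hQr]; exact hs) (Finset.mem_compl.1 ha)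
    simpa only [compl_compl] using this
  have hZc : Qᶜ.card = n + p + 1 := by
    rw [Finset.card_compl, hV, hQc]; omega
  obtain ⟨S, hSZ, hSc⟩ := Finset.exists_subset_card_eq (show p + 1 ≤ Qᶜ.card by omega)
  obtain ⟨z, hz⟩ := Finset.card_pos.1 (show 0 < (Qᶜ \ S).card by
    rw [Finset.card_sdiff_of_subset hSZ]; omega)
  rw [Finset.mem_sdiff] at hz
  obtain ⟨hzZ, hzS⟩ := hz
  obtain ⟨l, hl⟩ := exists_cyc disjoint_compl_left hQc hdQ S
    (Finset.card_pos.1 (by omega)) hSZ (by omega)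
  have hzl : z ∉ l := fun h => by
    rcases hl.sub z h with h | h
    · exact hzS h
    · exact Finset.mem_compl.1 hzZ h
  -- the red cycle
  obtain ⟨f, hf, hfr⟩ := cycleMap_of_list (k := 2 * p + 1) l (by rw [hl.len, hSc]; omega) hl.nodup
    (hl.chain.imp fun _ _ h => h.1)
  set C := l.toFinset with hC
  have hCc : C.card = 2 * p + 2 := by
    rw [hC, List.toFinset_card_of_nodup hl.nodup, hl.len, hSc]; omega
  have hCs : cycStat G (C : Set V) ≤ p - 1 := by
    have := (hmaxR f hf).trans hs
    rw [hfr] at this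
    simpa [hC] using this
  have hdC : ∀ a ∈ Cᶜ, p + 3 ≤ (C.filter (Gᶜ.Adj a)).card := fun a ha =>
    stat_bound hp hCc hCs (Finset.mem_compl.1 ha)
  have hRc : Cᶜ.card = n + p + 1 := by
    rw [Finset.card_compl, hV, hCc]; omega
  have hzC : z ∈ Cᶜ := by simpa [hC] using hzl
  have hsum : (Cᶜ.filter (G.Adj z)).card + (Cᶜ.filter (Gᶜ.Adj z)).card = n + p := by
    have h1 := Finset.card_filter_add_card_filter_not (s := Cᶜ.erase z) (G.Adj z)
    rw [Finset.card_erase_of_mem hzC, hRc] at h1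
    have e1 : (Cᶜ.erase z).filter (G.Adj z) = Cᶜ.filter (G.Adj z) := by
      ext v
      simp only [Finset.mem_filter, Finset.mem_erase]
      have : G.Adj z v → v ≠ z := fun h => h.ne'
      tauto
    have e2 : (Cᶜ.erase z).filter (fun v => ¬ G.Adj z v) = Cᶜ.filter (Gᶜ.Adj z) := by
      ext v
      simp only [Finset.mem_filter, Finset.mem_erase, SimpleGraph.compl_adj]
      have : v ≠ z ↔ z ≠ v := ne_comm
      tauto
    rw [e1, e2] at h1
    omega
  by_cases hred : n + 1 ≤ (Cᶜ.filter (G.Adj z)).card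
  · left
    obtain ⟨u, hu⟩ := Finset.card_pos.1 (show 0 < (Q.filter (G.Adj z) ∩ C).card by
      have h1 := hdQ z hzZ
      have h2 := Finset.card_sdiff_add_card_inter (Q.filter (G.Adj z)) C
      have h3 := Finset.card_sdiff_add_card_inter Q C
      have h4 := hl.card_out hSZ disjoint_compl_left
      have h5 : (Q.filter (G.Adj z) \ C).card ≤ (Q \ C).card :=
        Finset.card_le_card (Finset.sdiff_subset_sdiff (Finset.filter_subset _ _) le_rfl)
      rw [← hC] at h4
      omega)
    rw [Finset.mem_inter, Finset.mem_filter] at hu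
    refine red_case hp disjoint_compl_left (fun a ha => ⟨Q.filter (G.Adj a),
      Finset.filter_subset _ _, hdQ a ha, fun v hv => (Finset.mem_filter.1 hv).2⟩) hl hSZ hSc
      hzZ hzl (by simpa [hC] using hu.2) hu.1.1 hu.1.2 _ hred
      (fun v hv => (Finset.mem_filter.1 hv).2) ?_
    intro v hv
    simpa [hC] using (Finset.mem_filter.1 hv).1
  · right
    obtain ⟨K, hK, hKc⟩ := Finset.exists_subset_card_eq
      (show n - 1 ≤ (Cᶜ.filter (Gᶜ.Adj z)).card by omega)
    have hKR : K ⊆ Cᶜ := hK.trans (Finset.filter_subset _ _)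
    have hKz : z ∉ K := fun h => (Finset.mem_filter.1 (hK h)).2.ne rfl
    obtain ⟨R', hzR', hR'sub, hR'c⟩ := Finset.exists_subsuperset_card_eq
      (s := {z}) (t := Cᶜ \ K) (n := p + 1)
      (by rw [Finset.singleton_subset_iff, Finset.mem_sdiff]; exact ⟨hzC, hKz⟩)
      (by simp) (by rw [Finset.card_sdiff_of_subset hKR]; omega)
    rw [Finset.singleton_subset_iff] at hzR'
    have hR'R : R' ⊆ Cᶜ := hR'sub.trans Finset.sdiff_subset
    obtain ⟨l2, hl2⟩ := exists_cyc (H := Gᶜ) disjoint_compl_left hCc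
      (fun a ha => by convert hdC a ha) R' ⟨z, hzR'⟩ hR'R (by omega)
    have hout := nbr_out hl2 hR'R disjoint_compl_left (C.filter (Gᶜ.Adj z))
      (Finset.filter_subset _ _) (hdC z hzC)
    have hdis : Disjoint K (C.filter (Gᶜ.Adj z) \ l2.toFinset) := by
      rw [Finset.disjoint_left]
      intro v hv hv'
      exact Finset.mem_compl.1 (hKR hv) (Finset.mem_filter.1 (Finset.mem_sdiff.1 hv').1).1
    refine blue_case hp disjoint_compl_left (fun a ha => ⟨C.filter (Gᶜ.Adj a),
      Finset.filter_subset _ _, hdC a ha, fun v hv => (Finset.mem_filter.1 hv).2⟩) hl2 hR'R hR'c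
      hzR' (K ∪ (C.filter (Gᶜ.Adj z) \ l2.toFinset)) ?_ ?_ ?_
    · rw [Finset.card_union_of_disjoint hdis]
      omega
    · intro v hv
      rw [Finset.mem_union, Finset.mem_sdiff] at hv
      rcases hv with hv | hv
      · exact (Finset.mem_filter.1 (hK hv)).2
      · exact (Finset.mem_filter.1 hv.1).2
    · intro v hv hvl
      rw [Finset.mem_union, Finset.mem_sdiff] at hv
      rcases hv with hv | hv
      · rcases hl2.sub v hvl with h | h
        · exact (Finset.mem_sdiff.1 (hR'sub h)).2 hv
        · exact Finset.mem_compl.1 (hKR hv) h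
      · exact hv.2 (by simpa using hvl)
end

section
/- Let p ≥ 1 and n be integers with 2 ≤ n ≤ p, and set c = 2p+1. Consider a 2-coloring of the edges of the complete graph on a vertex set V with |V| = n + 3p + 3. Let Q be a blue cycle on 2p+2 vertices such that s(Q) ≥ s(C) for every monochromatic cycle C on 2p+2 vertices in this coloring. If s(Q) = p, then the coloring contains a monochromatic copy of S_c(n,2). -/
open SimpleGraph

def BipR {V : Type*} (H : SimpleGraph V) (S B : Finset V) (x y : V) : Prop :=
  H.Adj x y ∧ ((x ∈ S ∧ y ∈ B) ∨ (x ∈ B ∧ y ∈ S))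

/-- Alternating path that begins and ends in `S`. -/
def AltP {V : Type*} (H : SimpleGraph V) (S B : Finset V) (l : List V) : Prop :=
  l ≠ [] ∧ l.Nodup ∧ l.IsChain (BipR H S B) ∧ (∀ x ∈ l.head?, x ∈ S) ∧ (∀ x ∈ l.getLast?, x ∈ S)

theorem BipR.symm {V : Type*} {H : SimpleGraph V} {S B : Finset V} {x y : V}
    (h : BipR H S B x y) : BipR H S B y x :=
  ⟨h.1.symm, by have := h.2; tauto⟩

theorem alt_count {V : Type*} [DecidableEq V] (H : SimpleGraph V) (S B : Finset V)
    (hd : Disjoint S B) : ∀ l : List V, l ≠ [] → l.IsChain (BipR H S B) →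
    (∀ x ∈ l.head?, x ∈ S) → (∀ x ∈ l.getLast?, x ∈ S) →
    (l.filter (· ∈ B)).length + 1 = (l.filter (· ∈ S)).length ∧
      (∀ x ∈ l, x ∈ S ∨ x ∈ B)
  | [], h, _, _, _ => absurd rfl h
  | [x], _, _, h, _ => by
      have hx : x ∈ S := h x (by simp)
      have hx' : x ∉ B := Finset.disjoint_left.1 hd hx
      simp [hx, hx']
  | [x, y], _, hc, h, h' => by
      exfalso
      have hx : x ∈ S := h x (by simp)
      have hy : y ∈ S := h' y (by simp)
      have hx' : x ∉ B := Finset.disjoint_left.1 hd hx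
      have hy' : y ∉ B := Finset.disjoint_left.1 hd hy
      simp [BipR, hx', hy'] at hc
  | x :: y :: z :: l, _, hc, h, h' => by
      have hx : x ∈ S := h x (by simp)
      have hx' : x ∉ B := Finset.disjoint_left.1 hd hx
      rw [List.isChain_cons_cons, List.isChain_cons_cons] at hc
      obtain ⟨h1, h2, h3⟩ := hc
      have hy : y ∈ B := by have := h1.2; tauto
      have hy' : y ∉ S := Finset.disjoint_right.1 hd hy
      have hz : z ∈ S := by have := h2.2; tauto
      have ih := alt_count H S B hd (z :: l) (by simp) h3 (by simpa using hz)
        (by simpa [List.getLast?_cons_cons] using h')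
      obtain ⟨ih1, ih2⟩ := ih
      refine ⟨?_, ?_⟩
      · have e1 : (x :: y :: z :: l).filter (· ∈ B) = y :: (z :: l).filter (· ∈ B) := by
          rw [List.filter_cons_of_neg (by simpa using hx'), List.filter_cons_of_pos (by simpa using hy)]
        have e2 : (x :: y :: z :: l).filter (· ∈ S) = x :: (z :: l).filter (· ∈ S) := by
          rw [List.filter_cons_of_pos (by simpa using hx), List.filter_cons_of_neg (by simpa using hy')]
        rw [e1, e2, List.length_cons, List.length_cons]
        omega
      · intro w hw
        simp only [List.mem_cons] at hw ih2
        rcases hw with rfl | rfl | hw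
        · exact Or.inl hx
        · exact Or.inr hy
        · exact ih2 w hw

theorem card_filter_toFinset {V : Type*} [DecidableEq V] (l : List V) (hl : l.Nodup) (S : Finset V) :
    (l.filter (· ∈ S)).length = (S.filter (· ∈ l)).card := by
  rw [← List.toFinset_card_of_nodup (hl.filter _)]
  congr 1
  ext x; simp [and_comm]

theorem AltP.count {V : Type*} [DecidableEq V] {H : SimpleGraph V} {S B : Finset V}
    (hd : Disjoint S B) {l : List V} (h : AltP H S B l) :
    (B.filter (· ∈ l)).card + 1 = (S.filter (· ∈ l)).card ∧ (∀ x ∈ l, x ∈ S ∨ x ∈ B) ∧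
    l.length = (B.filter (· ∈ l)).card + (S.filter (· ∈ l)).card := by
  obtain ⟨h0, h1, h2, h3, h4⟩ := h
  have := alt_count H S B hd l h0 h2 h3 h4
  rw [card_filter_toFinset l h1, card_filter_toFinset l h1] at this
  refine ⟨this.1, this.2, ?_⟩
  rw [← List.toFinset_card_of_nodup h1, ← Finset.card_union_of_disjoint]
  · congr 1
    ext x
    have := this.2 x
    simp; tauto
  · exact Finset.disjoint_filter_filter (hd.symm)

/-- first exchange -/
theorem AltP.ext1 {V : Type*} {H : SimpleGraph V} {S B : Finset V}
    {l : List V} (h : AltP H S B l)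
    {s v y : V} {l1 l2 : List V} (hl : l = l1 ++ v :: l2) (hv : v ∈ S)
    (hs : s ∈ S) (hsl : s ∉ l) (hc : (l1 ++ [s]).IsChain (BipR H S B))
    (hy : y ∈ B) (hyl : y ∉ l) (hys : H.Adj s y) (hyv : H.Adj v y) :
    ∃ l', AltP H S B l' ∧ l.length < l'.length := by
  subst hl
  obtain ⟨h0, h1, h2, h3, h4⟩ := h
  have hsy : s ≠ y := hys.ne
  refine ⟨l1 ++ s :: y :: v :: l2, ⟨by simp, ?_, ?_, ?_, ?_⟩, by simp⟩
  · grind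
  · rw [List.isChain_split] at h2 ⊢
    refine ⟨hc, ?_⟩
    rw [List.isChain_cons_cons, List.isChain_cons_cons]
    exact ⟨⟨hys, Or.inl ⟨hs, hy⟩⟩, ⟨hyv.symm, Or.inr ⟨hy, hv⟩⟩, h2.2⟩
  · cases l1 <;> simp_all
  · simpa [List.getLast?_append, List.getLast?_cons_cons] using h4

theorem AltP.ext2 {V : Type*} {H : SimpleGraph V} {S B : Finset V}
    (hd : Disjoint S B) {l : List V} (h : AltP H S B l)
    {s v v' y : V} {l1 m l2 : List V} (hl : l = l1 ++ v :: (m ++ v' :: l2)) (hv : v ∈ S) (hv' : v' ∈ S)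
    (hs : s ∈ S) (hsl : s ∉ l) (hc : (l1 ++ [s]).IsChain (BipR H S B))
    (hc' : (l1 ++ v :: (m ++ [s])).IsChain (BipR H S B))
    (hy : y ∈ B) (hyl : y ∉ l) (hyv : H.Adj v y) (hyv' : H.Adj v' y) :
    ∃ l', AltP H S B l' ∧ l.length < l'.length := by
  subst hl
  obtain ⟨h0, h1, h2, h3, h4⟩ := h
  have hsy : s ≠ y := fun h => Finset.disjoint_left.1 hd hs (h ▸ hy)
  refine ⟨l1 ++ s :: (m.reverse ++ v :: y :: v' :: l2), ⟨by simp, ?_, ?_, ?_, ?_⟩, by simp⟩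
  · have hp : (l1 ++ s :: (m.reverse ++ v :: y :: v' :: l2)).Perm
        (s :: y :: (l1 ++ v :: (m ++ v' :: l2))) := by
      classical
      rw [List.perm_iff_count]
      intro a
      simp only [List.count_append, List.count_cons, List.count_reverse]
      omega
    rw [hp.nodup_iff]
    simp only [List.nodup_cons]
    refine ⟨?_, hyl, h1⟩
    simp only [List.mem_cons, not_or]
    exact ⟨hsy, hsl⟩
  · rw [List.isChain_split] at h2 ⊢ hc'
    refine ⟨hc, ?_⟩
    have e1 : (v :: (m ++ [s])).reverse.IsChain (BipR H S B) := by
      rw [List.isChain_reverse]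
      exact hc'.2.imp fun a b h => h.symm
    have e2 : (v :: (m ++ [s])).reverse = (s :: m.reverse) ++ [v] := by simp
    rw [e2] at e1
    have e3 : s :: (m.reverse ++ v :: y :: v' :: l2) = (s :: m.reverse) ++ v :: (y :: v' :: l2) := by simp
    rw [e3, List.isChain_split]
    refine ⟨e1, ?_⟩
    rw [List.isChain_cons_cons, List.isChain_cons_cons]
    refine ⟨⟨hyv, Or.inl ⟨hv, hy⟩⟩, ⟨hyv'.symm, Or.inr ⟨hy, hv'⟩⟩, ?_⟩
    have := h2.2
    rw [← List.cons_append, List.isChain_split] at this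
    exact this.2
  · cases l1 <;> simp_all
  · have e : ∀ l3 : List V, (l3 ++ v' :: l2).getLast? = (v' :: l2).getLast? := by
      intro l3
      rw [List.getLast?_append]
      simp [List.getLast?_cons]
    have e1 : l1 ++ v :: (m ++ v' :: l2) = (l1 ++ v :: m) ++ v' :: l2 := by simp
    have e2 : l1 ++ s :: (m.reverse ++ v :: y :: v' :: l2)
      = (l1 ++ s :: (m.reverse ++ [v, y])) ++ v' :: l2 := by simp
    rw [e1, e] at h4
    rw [e2, e]
    exact h4

open Classical in
/-- A version of Jackson's theorem for paths. -/
theorem path_lemma {V : Type*} [Fintype V] (H : SimpleGraph V) (S B : Finset V)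
    (hd : Disjoint S B) (k : ℕ) (hk : ∀ s ∈ S, k ≤ (B.filter (fun b => H.Adj s b)).card)
    (hB : B.card < 2 * k) (hSk : S.card ≤ k) (hS : S.Nonempty) :
    ∃ l, AltP H S B l ∧ ∀ s ∈ S, s ∈ l := by
  have hbdd : ∀ l, AltP H S B l → l.length ≤ Fintype.card V := fun l h => h.2.1.length_le_card
  obtain ⟨s0, hs0⟩ := hS
  have hne : ∃ m l, AltP H S B l ∧ l.length = m := ⟨1, [s0], by simp [AltP, hs0], rfl⟩
  have hex : ∃ l, AltP H S B l ∧ ∀ l', AltP H S B l' → l'.length ≤ l.length := by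
    by_contra! hcon
    have : ∀ m : ℕ, ∃ l, AltP H S B l ∧ m ≤ l.length := by
      intro m
      induction m with
      | zero => obtain ⟨m, l, h, _⟩ := hne; exact ⟨l, h, by omega⟩
      | succ m ih =>
        obtain ⟨l, h, h'⟩ := ih
        obtain ⟨l', h1, h2⟩ := hcon l h
        exact ⟨l', h1, by omega⟩
    obtain ⟨l, h, h'⟩ := this (Fintype.card V + 1)
    have := hbdd l h
    omega
  obtain ⟨l, hl, hmax⟩ := hex
  refine ⟨l, hl, ?_⟩
  by_contra! hcon
  obtain ⟨s, hs, hsl⟩ := hcon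
  obtain ⟨hcnt, hSB, hlen⟩ := hl.count hd
  have hl' := hl
  obtain ⟨h0, h1, h2, h3, h4⟩ := hl'
  have hpos : 0 < l.length := List.length_pos_iff.2 h0
  -- good vertices
  let Good : V → Prop := fun v => v ∈ S ∧ ∃ l1 l2, l = l1 ++ v :: l2 ∧
    (l1 ++ [s]).IsChain (BipR H S B)
  have hhead : Good (l[0]) := by
    refine ⟨h3 _ (by rw [List.head?_eq_getElem?]; simp [hpos]), [], l.drop 1, ?_, by simp⟩
    cases l <;> simp_all
  let I := B.filter (fun b => H.Adj s b ∧ b ∈ l)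
  have hsucc : ∀ b ∈ I, ∃ i, ∃ h : i + 1 < l.length, l[i] = b ∧ Good (l[i+1]) := by
    intro b hb
    simp only [I, Finset.mem_filter] at hb
    obtain ⟨hbB, hsb, hbl⟩ := hb
    have hbS : b ∉ S := Finset.disjoint_right.1 hd hbB
    obtain ⟨i, hi, hib⟩ := List.getElem_of_mem hbl
    have hi' : i + 1 < l.length := by
      by_contra hcon
      have : i = l.length - 1 := by omega
      apply hbS
      apply h4
      rw [List.getLast?_eq_getElem?, ← this, ← hib]
      simp [hi]
    have hdec : l = l.take (i+1) ++ l[i+1] :: l.drop (i+2) := by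
      rw [List.getElem_cons_drop, List.take_append_drop]
    have hR : BipR H S B (l[i]) (l[i+1]) := by
      have := List.isChain_iff_getElem.1 h2 i hi'
      exact this
    refine ⟨i, hi', hib, ?_, l.take (i+1), l.drop (i+2), hdec, ?_⟩
    · have := hR.2; rw [hib] at this; tauto
    · rw [List.isChain_append]
      refine ⟨h2.take _, by simp, ?_⟩
      intro x hx y hy
      simp at hy
      subst hy
      have : x = b := by
        rw [List.getLast?_take] at hx
        simp [hi, hib] at hx
        exact hx.symm
      subst this
      exact ⟨hsb.symm, Or.inr ⟨hbB, hs⟩⟩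
  let K := Finset.univ.filter Good
  have hK : I.card + 1 ≤ K.card := by
    choose! i hi hib hig using hsucc
    have : (insert l[0] (I.attach.image (fun b => l[i b.1 + 1]'(hi b.1 b.2)))).card = I.card + 1 := by
      rw [Finset.card_insert_of_notMem, Finset.card_image_of_injective, Finset.card_attach]
      · intro b b' hbb
        have := (h1.getElem_inj_iff).1 hbb
        apply Subtype.ext
        rw [← hib b.1 b.2, ← hib b'.1 b'.2]
        congr 1
        omega
      · intro hmem
        rw [Finset.mem_image] at hmem
        obtain ⟨b, _, hb⟩ := hmem
        have := (h1.getElem_inj_iff).1 hb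
        omega
    rw [← this]
    apply Finset.card_le_card
    intro v hv
    rw [Finset.mem_insert, Finset.mem_image] at hv
    simp only [K, Finset.mem_filter, Finset.mem_univ, true_and]
    rcases hv with rfl | ⟨b, _, rfl⟩
    · exact hhead
    · exact hig b.1 b.2
  let X : V → Finset V := fun v => B.filter (fun b => H.Adj v b ∧ b ∉ l)
  have hXs : ∀ v ∈ K, Disjoint (X s) (X v) := by
    intro v hv
    simp only [K, Finset.mem_filter, Finset.mem_univ, true_and] at hv
    obtain ⟨hvS, l1, l2, hdec, hch⟩ := hv
    rw [Finset.disjoint_left]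
    intro y hy hy'
    simp only [X, Finset.mem_filter] at hy hy'
    obtain ⟨l', hl', hlt⟩ := hl.ext1 hdec hvS hs hsl hch hy.1 hy.2.2 hy.2.1 hy'.2.1
    have := hmax l' hl'
    omega
  have hXX' : ∀ v ∈ K, ∀ v' ∈ K, v ≠ v' → ∀ l1 l2 l1' l2', l = l1 ++ v :: l2 →
      (l1 ++ [s]).IsChain (BipR H S B) → l = l1' ++ v' :: l2' →
      (l1' ++ [s]).IsChain (BipR H S B) → l1.length < l1'.length → Disjoint (X v) (X v') := by
    intro v hv v' hv' hne l1 l2 l1' l2' hdec hch hdec' hch' hlt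
    simp only [K, Finset.mem_filter, Finset.mem_univ, true_and] at hv hv'
    have hm : ∃ m, l1' = l1 ++ v :: m := by
      have e := hdec.symm.trans hdec'
      rw [List.append_eq_append_iff] at e
      rcases e with ⟨a, ha, hb⟩ | ⟨a, ha, hb⟩
      · cases a with
        | nil => simp at hb; exact absurd hb.1 hne
        | cons x a =>
          simp at hb
          exact ⟨a, by rw [ha, hb.1]⟩
      · rw [ha] at hlt
        simp at hlt
    obtain ⟨m, rfl⟩ := hm
    rw [Finset.disjoint_left]
    intro y hy hy'
    simp only [X, Finset.mem_filter] at hy hy'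
    obtain ⟨l', hl', hlt⟩ := hl.ext2 hd (by simpa using hdec') hv.1 hv'.1 hs hsl hch
      (by simpa using hch') hy.1 hy.2.2 hy.2.1 hy'.2.1
    have := hmax l' hl'
    omega
  have hXX : ∀ v ∈ K, ∀ v' ∈ K, v ≠ v' → Disjoint (X v) (X v') := by
    intro v hv v' hv' hne
    have hv1 := hv
    have hv1' := hv'
    simp only [K, Finset.mem_filter, Finset.mem_univ, true_and] at hv1 hv1'
    obtain ⟨hvS, l1, l2, hdec, hch⟩ := hv1
    obtain ⟨hvS', l1', l2', hdec', hch'⟩ := hv1'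
    rcases lt_trichotomy l1.length l1'.length with hlt | heq | hlt
    · exact hXX' v hv v' hv' hne l1 l2 l1' l2' hdec hch hdec' hch' hlt
    · exfalso
      have e := hdec.symm.trans hdec'
      have := List.append_inj e heq
      simp at this
      exact hne this.2.1
    · exact (hXX' v' hv' v hv hne.symm l1' l2' l1 l2 hdec' hch' hdec hch hlt).symm
  set β := (B.filter (· ∈ l)).card with hβ
  have hXcard : ∀ v ∈ K, k - β ≤ (X v).card := by
    intro v hv
    simp only [K, Finset.mem_filter, Finset.mem_univ, true_and] at hv
    have h5 := hk v hv.1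
    have h6 : (B.filter (fun b => H.Adj v b)) ⊆ X v ∪ B.filter (· ∈ l) := by
      intro x hx
      simp only [X, Finset.mem_union, Finset.mem_filter] at hx ⊢
      tauto
    have := (Finset.card_le_card h6).trans (Finset.card_union_le _ _)
    omega
  have hXscard : k ≤ (X s).card + I.card := by
    have h5 := hk s hs
    have h6 : (B.filter (fun b => H.Adj s b)) ⊆ X s ∪ I := by
      intro x hx
      simp only [X, I, Finset.mem_union, Finset.mem_filter] at hx ⊢
      tauto
    have := (Finset.card_le_card h6).trans (Finset.card_union_le _ _)
    omega
  have hβk : β + 1 ≤ k - 1 + 1 ∧ 1 ≤ k := by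
    have : (S.filter (· ∈ l)).card < S.card := by
      apply Finset.card_lt_card
      rw [Finset.filter_ssubset]
      exact ⟨s, hs, hsl⟩
    omega
  have htot : (X s).card + (∑ v ∈ K, (X v).card) + β ≤ B.card := by
    rw [← Finset.card_biUnion (fun v hv v' hv' h => hXX v hv v' hv' h),
      ← Finset.card_union_of_disjoint, ← Finset.card_union_of_disjoint]
    · apply Finset.card_le_card
      intro x hx
      simp only [X, Finset.mem_union, Finset.mem_filter, Finset.mem_biUnion] at hx
      rcases hx with (hx | ⟨_, _, hx⟩) | hx <;> exact hx.1
    · rw [Finset.disjoint_left]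
      intro x hx hx'
      simp only [X, Finset.mem_union, Finset.mem_filter, Finset.mem_biUnion] at hx hx'
      rcases hx with hx | ⟨_, _, hx⟩ <;> exact hx.2.2 hx'.2
    · rw [Finset.disjoint_biUnion_right]
      exact hXs
  have hsum : (I.card + 1) * (k - β) ≤ ∑ v ∈ K, (X v).card := by
    calc (I.card + 1) * (k - β) ≤ K.card * (k - β) := Nat.mul_le_mul_right _ hK
      _ ≤ _ := by
        rw [← smul_eq_mul]
        exact Finset.card_nsmul_le_sum _ _ _ hXcard
  obtain ⟨d, hd'⟩ : ∃ d, k = β + d + 1 := ⟨k - β - 1, by omega⟩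
  have e : k - β = d + 1 := by omega
  rw [e] at hsum
  have : I.card * d ≥ 0 := Nat.zero_le _
  nlinarith

theorem embed_lds {V : Type*} (H : SimpleGraph V) (c n : ℕ) (l : List V) (hlen : l.length = c)
    (x y : V) (hx : l.head? = some x) (hy : l.getLast? = some y) (hnd : l.Nodup)
    (hch : l.IsChain H.Adj) (A D : Finset V) (hA : n ≤ A.card) (hD : 2 ≤ D.card)
    (hAx : ∀ a ∈ A, H.Adj x a) (hDy : ∀ a ∈ D, H.Adj y a) (hAl : ∀ a ∈ A, a ∉ l)
    (hDl : ∀ a ∈ D, a ∉ l) (hAD : Disjoint A D) :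
    HasCopy (LinkedDoubleStar c n 2) H := by
  subst hlen
  obtain ⟨eA⟩ : Nonempty (Fin n ↪ A) := Function.Embedding.nonempty_of_card_le (by simpa using hA)
  obtain ⟨eD⟩ : Nonempty (Fin 2 ↪ D) := Function.Embedding.nonempty_of_card_le (by simpa using hD)
  have hpos : 0 < l.length := by cases l <;> simp_all
  let f : Fin l.length ⊕ Fin n ⊕ Fin 2 → V := fun v => match v with
    | Sum.inl i => l[i]
    | Sum.inr (Sum.inl j) => (eA j).1
    | Sum.inr (Sum.inr j) => (eD j).1
  have hADne : ∀ i j, (eA i).1 ≠ (eD j).1 := fun i j h =>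
    Finset.disjoint_left.1 hAD (eA i).2 (h ▸ (eD j).2)
  have hlA : ∀ (i : Fin l.length) j, l[i] ≠ (eA j).1 := fun i j h =>
    hAl _ (eA j).2 (h ▸ List.getElem_mem _)
  have hlD : ∀ (i : Fin l.length) j, l[i] ≠ (eD j).1 := fun i j h =>
    hDl _ (eD j).2 (h ▸ List.getElem_mem _)
  have hx0 : l[0] = x := by
    rw [List.head?_eq_getElem?] at hx
    simpa [hpos] using hx
  have hy0 : l[l.length - 1] = y := by
    rw [List.getLast?_eq_getElem?] at hy
    simpa [hpos] using hy
  have hrel : ∀ a b, ldsRel l.length n 2 a b → H.Adj (f a) (f b) := by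
    rintro (i | i | i) (j | j | j) h <;> simp only [ldsRel] at h
    · have := List.isChain_iff_getElem.1 hch i (by omega)
      have e : (l[j] : V) = l[(i : ℕ) + 1]'(by omega) := by simp [← h]
      simp only [f]
      rw [e]
      exact this
    · have e : (l[i] : V) = x := by rw [← hx0]; simp [h]
      simp only [f]
      rw [e]
      exact hAx _ (eA j).2
    · have e : (l[i] : V) = y := by rw [← hy0]; simp [h]
      simp only [f]
      rw [e]
      exact hDy _ (eD j).2
  refine ⟨f, ?_, ?_⟩
  · rintro (i | i | i) (j | j | j) h <;> simp only [f] at h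
    · congr 1
      apply Fin.ext
      exact (hnd.getElem_inj_iff).1 h
    · exact absurd h (hlA i j)
    · exact absurd h (hlD i j)
    · exact absurd h.symm (hlA j i)
    · congr 2
      exact eA.injective (Subtype.ext h)
    · exact absurd h (hADne i j)
    · exact absurd h.symm (hlD j i)
    · exact absurd h.symm (hADne j i)
    · congr 2
      exact eD.injective (Subtype.ext h)
  · intro a b hab
    rw [LinkedDoubleStar, SimpleGraph.fromRel_adj] at hab
    rcases hab.2 with h | h
    · exact hrel a b h
    · exact (hrel b a h).symm

theorem exists_mem_of_card_lt {V : Type*} [DecidableEq V] (A B : Finset V) (h : B.card < A.card) :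
    ∃ a ∈ A, a ∉ B := Finset.exists_mem_notMem_of_card_lt_card h

open Classical in
theorem red_main {V : Type*} [Fintype V] (G : SimpleGraph V) (p n : ℕ) (hp : 2 ≤ p) (hnp : n ≤ p)
    (Q Z : Finset V) (hd : Disjoint Q Z) (hQ : Q.card = 2 * p + 2) (hZ : Z.card = n + p + 1)
    (hz : ∀ z ∈ Z, p + 2 ≤ (Q.filter (fun q => G.Adj z q)).card)
    (u : V) (hu : u ∈ Z) (hS : (Q.filter (fun q => ¬ G.Adj u q)).card = p)
    (hdeg : ∀ s ∈ Q, ¬ G.Adj u s → p + 1 ≤ (Z.filter (fun z => G.Adj s z)).card) :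
    HasCopy (LinkedDoubleStar (2 * p + 1) n 2) G := by
  set S := Q.filter (fun q => ¬ G.Adj u q) with hSdef
  have hSQ : S ⊆ Q := Finset.filter_subset _ _
  have hSZ : Disjoint S (Z.erase u) :=
    Finset.disjoint_of_subset_left hSQ (Finset.disjoint_of_subset_right (Finset.erase_subset _ _) hd)
  have hdeg' : ∀ s ∈ S, p + 1 ≤ ((Z.erase u).filter (fun z => G.Adj s z)).card := by
    intro s hs
    simp only [hSdef, Finset.mem_filter] at hs
    refine (hdeg s hs.1 hs.2).trans (Finset.card_le_card ?_)
    intro z hz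
    simp only [Finset.mem_filter, Finset.mem_erase] at hz ⊢
    refine ⟨⟨?_, hz.1⟩, hz.2⟩
    rintro rfl
    exact hs.2 hz.2.symm
  obtain ⟨l, hl, hcov⟩ := path_lemma G S (Z.erase u) hSZ (p + 1) hdeg'
    (by rw [Finset.card_erase_of_mem hu]; omega) (by omega) (Finset.card_pos.1 (by omega))
  obtain ⟨hcnt, hSB, hlen⟩ := hl.count hSZ
  have hfull : S.filter (· ∈ l) = S := Finset.filter_true_of_mem hcov
  rw [hfull, hS] at hcnt hlen
  obtain ⟨h0, h1, h2, h3, h4⟩ := hl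
  have hpQZ : ∀ q ∈ Q, ∀ z ∈ Z, q ≠ z := fun q hq z hz h => Finset.disjoint_left.1 hd hq (h ▸ hz)
  match l, hlen with
  | [], hlen => simp at hlen; omega
  | [_], hlen => simp at hlen; omega
  | s :: z2 :: t, hlen =>
    have hs : s ∈ S := h3 s (by simp)
    rw [List.isChain_cons_cons] at h2
    have hz2 : z2 ∈ Z.erase u := by
      have := h2.1.2
      have h' := Finset.disjoint_left.1 hSZ hs
      tauto
    obtain ⟨e, he⟩ : ∃ e, (z2 :: t).getLast? = some e := ⟨_, List.getLast?_eq_some_getLast (by simp)⟩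
    have heS : e ∈ S := h4 e (by rw [List.getLast?_cons_cons]; exact he)
    obtain ⟨z1, hz1, hz1l⟩ := exists_mem_of_card_lt _ _ (lt_of_lt_of_le (by omega) (hdeg' e heS) :
      ((Z.erase u).filter (· ∈ s :: z2 :: t)).card < _)
    simp only [Finset.mem_filter, not_and] at hz1 hz1l
    have hz1l := hz1l hz1.1
    have hz1Z : z1 ∈ Z := Finset.mem_of_mem_erase hz1.1
    have hz2Z : z2 ∈ Z := Finset.mem_of_mem_erase hz2
    obtain ⟨q0, hq0, hq0S⟩ := exists_mem_of_card_lt _ _ (lt_of_lt_of_le (by omega) (hz z1 hz1Z) :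
      S.card < _)
    simp only [Finset.mem_filter] at hq0
    have huq0 : G.Adj u q0 := by
      by_contra h
      exact hq0S (Finset.mem_filter.2 ⟨hq0.1, h⟩)
    obtain ⟨d, hdm, hdS⟩ := exists_mem_of_card_lt _ _ (lt_of_le_of_lt (Finset.card_insert_le q0 S)
      (lt_of_lt_of_le (by omega) (hz z2 hz2Z)))
    simp only [Finset.mem_filter] at hdm
    simp only [Finset.mem_insert, not_or] at hdS
    have hmem : ∀ x ∈ z2 :: t, x ≠ s ∧ (x ∈ S ∨ x ∈ Z.erase u) := by
      intro x hx
      refine ⟨?_, hSB x (List.mem_cons_of_mem _ hx)⟩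
      rintro rfl
      rw [List.nodup_cons] at h1
      exact h1.1 hx
    have hQout : ∀ x ∈ Q, x ≠ q0 → (x ∉ S ∨ x = s) → x ∉ u :: q0 :: z1 :: (z2 :: t).reverse := by
      intro x hxQ hx0 hxS hx
      simp only [List.mem_cons, List.mem_reverse] at hx
      rcases hx with rfl | rfl | rfl | hx
      · exact hpQZ _ hxQ _ hu rfl
      · exact hx0 rfl
      · exact hpQZ _ hxQ _ hz1Z rfl
      · rw [← List.mem_cons] at hx
        have := hmem x hx
        rcases this.2 with h | h
        · rcases hxS with h' | h'
          · exact h' h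
          · exact this.1 h'
        · exact hpQZ _ hxQ _ (Finset.mem_of_mem_erase h) rfl
    refine embed_lds G (2 * p + 1) n (u :: q0 :: z1 :: (z2 :: t).reverse) ?_ u z2 rfl ?_ ?_ ?_
      ((Q \ S) \ {q0, d}) {s, d} ?_ ?_ ?_ ?_ ?_ ?_ ?_
    · rw [List.length_cons, List.length_cons] at hlen; simp only [List.length_cons, List.length_reverse]; omega
    · simp [List.getLast?_cons]
    · rw [List.nodup_cons, List.nodup_cons, List.nodup_cons, List.nodup_reverse]
      rw [List.nodup_cons] at h1
      refine ⟨?_, ?_, ?_, h1.2⟩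
      · simp only [List.mem_cons, List.mem_reverse, not_or]
        rw [← not_or, ← List.mem_cons]
        have hq : u ≠ q0 := fun h => hpQZ _ hq0.1 _ hu h.symm
        have hq' : u ≠ z1 := (Finset.ne_of_mem_erase hz1.1).symm
        have hq'' : u ∉ z2 :: t := fun h => by
          rcases (hmem u h).2 with h | h
          · exact hpQZ _ (hSQ h) _ hu rfl
          · simp at h
        simp only [List.mem_cons, not_or] at hq'' ⊢
        tauto
      · have hq : q0 ≠ z1 := fun h => hpQZ _ hq0.1 _ hz1Z h
        have hq'' : q0 ∉ z2 :: t := fun h => by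
          rcases (hmem _ h).2 with h | h
          · exact hq0S h
          · exact hpQZ _ hq0.1 _ (Finset.mem_of_mem_erase h) rfl
        rw [List.mem_cons, List.mem_reverse]
        tauto
      · rw [List.mem_reverse]
        exact fun h => hz1l (List.mem_cons_of_mem _ h)
    · rw [List.isChain_cons_cons, List.isChain_cons_cons, List.isChain_cons]
      refine ⟨huq0, hq0.2.symm, ?_, ?_⟩
      · intro w hw
        rw [List.head?_reverse, he] at hw
        simp at hw
        subst hw
        exact hz1.2.symm
      · rw [List.isChain_reverse]
        exact h2.2.imp fun a b h => h.1.symm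
    · have e1 : (Q \ S).card = p + 2 := by rw [Finset.card_sdiff_of_subset hSQ]; omega
      have e2 := Finset.le_card_sdiff {q0, d} (Q \ S)
      have e3 : ({q0, d} : Finset V).card ≤ 2 := Finset.card_le_two
      omega
    · rw [Finset.card_pair]
      rintro rfl
      exact hdS.2 hs
    · intro a ha
      simp only [Finset.mem_sdiff, hSdef, Finset.mem_filter, not_and, not_not] at ha
      exact ha.1.2 ha.1.1
    · intro a ha
      simp only [Finset.mem_insert, Finset.mem_singleton] at ha
      rcases ha with rfl | rfl
      · exact h2.1.1.symm
      · exact hdm.2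
    · intro a ha
      simp only [Finset.mem_sdiff, Finset.mem_insert, Finset.mem_singleton, not_or] at ha
      exact hQout a ha.1.1 ha.2.1 (Or.inl ha.1.2)
    · intro a ha
      simp only [Finset.mem_insert, Finset.mem_singleton] at ha
      rcases ha with rfl | rfl
      · exact hQout _ (hSQ hs) (fun h => hq0S (h ▸ hs)) (Or.inr rfl)
      · exact hQout _ hdm.1 hdS.1 (Or.inl hdS.2)
    · rw [Finset.disjoint_left]
      intro a ha ha'
      simp only [Finset.mem_sdiff, Finset.mem_insert, Finset.mem_singleton, not_or] at ha ha'
      rcases ha' with rfl | rfl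
      · exact ha.1.2 hs
      · exact ha.2.2 rfl

open Classical in
theorem red_full {V : Type*} [Fintype V] (G : SimpleGraph V) (p n : ℕ) (hp : 2 ≤ p) (hnp : n ≤ p)
    (hn : 2 ≤ n)
    (Q Z : Finset V) (hd : Disjoint Q Z) (hZ : Z.card = n + p + 1)
    (f g y : V) (hf : f ∈ Q) (hg : g ∈ Q) (hy : y ∈ Q) (hfg : f ≠ g) (hyg : y ≠ g)
    (hfy : G.Adj f y) (hfZ : ∀ z ∈ Z, G.Adj f z) (hgZ : ∀ z ∈ Z, G.Adj g z)
    (E : Finset V) (hEQ : E ⊆ Q) (hE : E.card = p - 1) (hfE : f ∉ E) (hgE : g ∉ E) (hyE : y ∉ E)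
    (hdeg : ∀ s ∈ E, p + 1 ≤ (Z.filter (fun z => G.Adj s z)).card) :
    HasCopy (LinkedDoubleStar (2 * p + 1) n 2) G := by
  have hEZ : Disjoint E Z := Finset.disjoint_of_subset_left hEQ hd
  obtain ⟨l, hl, hcov⟩ := path_lemma G E Z hEZ (p + 1) hdeg
    (by omega) (by omega) (Finset.card_pos.1 (by omega))
  obtain ⟨hcnt, hSB, hlen⟩ := hl.count hEZ
  have hfull : E.filter (· ∈ l) = E := Finset.filter_true_of_mem hcov
  rw [hfull, hE] at hcnt hlen
  obtain ⟨h0, h1, h2, h3, h4⟩ := hl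
  have hpQZ : ∀ q ∈ Q, ∀ z ∈ Z, q ≠ z := fun q hq z hz h => Finset.disjoint_left.1 hd hq (h ▸ hz)
  obtain ⟨e1, he1⟩ : ∃ e, l.head? = some e := ⟨_, List.head?_eq_some_head h0⟩
  obtain ⟨e2, he2⟩ : ∃ e, l.getLast? = some e := ⟨_, List.getLast?_eq_some_getLast h0⟩
  have he1E := h3 e1 he1
  have he2E := h4 e2 he2
  obtain ⟨z0, hz0, hz0l⟩ := exists_mem_of_card_lt _ _ (lt_of_lt_of_le (by omega) (hdeg e1 he1E) :
      (Z.filter (· ∈ l)).card < _)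
  simp only [Finset.mem_filter, not_and] at hz0 hz0l
  have hz0l := hz0l hz0.1
  obtain ⟨z1, hz1, hz1l⟩ := exists_mem_of_card_lt _ _ (lt_of_le_of_lt
    (Finset.card_insert_le z0 (Z.filter (· ∈ l)))
    (lt_of_lt_of_le (by omega) (hdeg e2 he2E)))
  simp only [Finset.mem_filter, not_and, Finset.mem_insert, not_or] at hz1 hz1l
  have hz10 := hz1l.1
  have hz1l := hz1l.2 hz1.1
  have hQl : ∀ x ∈ Q, x ∉ E → x ∉ l := by
    intro x hx hxE hxl
    rcases hSB x hxl with h | h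
    · exact hxE h
    · exact hpQZ x hx x h rfl
  let W := Z \ (insert z0 (insert z1 (Z.filter (· ∈ l))))
  have hW : n + 1 ≤ W.card := by
    have a1 := Finset.le_card_sdiff (insert z0 (insert z1 (Z.filter (· ∈ l)))) Z
    have a2 := Finset.card_insert_le z0 (insert z1 (Z.filter (· ∈ l)))
    have a3 := Finset.card_insert_le z1 ((Z.filter (· ∈ l)))
    simp only [W]
    omega
  obtain ⟨D, hDW, hD⟩ := Finset.exists_subset_card_eq (s := W) (n := 2) (by omega)
  have hWprop : ∀ w ∈ W, w ∈ Z ∧ w ∉ f :: z0 :: (l ++ [z1, g]) := by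
    intro w hw
    simp only [W, Finset.mem_sdiff, Finset.mem_insert, Finset.mem_filter, not_or, not_and] at hw
    refine ⟨hw.1, ?_⟩
    simp only [List.mem_cons, List.mem_append, List.not_mem_nil, or_false, not_or]
    exact ⟨(hpQZ _ hf _ hw.1).symm, hw.2.1, hw.2.2.2 hw.1, hw.2.2.1, (hpQZ _ hg _ hw.1).symm⟩
  have hyl := hQl y hy hyE
  have hyW : y ∉ W := fun h => hpQZ y hy y (hWprop y h).1 rfl
  refine embed_lds G (2 * p + 1) n (f :: z0 :: (l ++ [z1, g])) ?_ f g rfl ?_ ?_ ?_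
      (insert y (W \ D)) D ?_ ?_ ?_ ?_ ?_ ?_ ?_
  · simp; omega
  · simp [List.getLast?_cons]
  · have a1 := hpQZ f hf z0 hz0.1
    have a2 := hpQZ f hf z1 hz1.1
    have a3 := hpQZ g hg z0 hz0.1
    have a4 := hpQZ g hg z1 hz1.1
    have a5 := hQl f hf hfE
    have a6 := hQl g hg hgE
    simp only [List.nodup_cons, List.mem_cons, List.mem_append, List.not_mem_nil, or_false, not_or,
      List.nodup_append, List.nodup_nil, and_true, not_false_eq_true]
    refine ⟨⟨a1, a5, a2, hfg⟩, ⟨hz0l, Ne.symm hz10, a3.symm⟩, h1, a4.symm, ?_⟩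
    rintro a ha b (rfl | rfl) rfl
    · exact hz1l ha
    · exact a6 ha
  · rw [List.isChain_cons_cons, List.isChain_cons, List.isChain_append]
    refine ⟨hfZ _ hz0.1, ?_, h2.imp fun a b h => h.1, ?_, ?_⟩
    · intro w hw
      rw [List.head?_append, he1] at hw
      simp at hw
      subst hw
      exact hz0.2.symm
    · simp [(hgZ _ hz1.1).symm]
    · intro a ha b hb
      rw [he2] at ha
      simp at ha hb
      subst ha hb
      exact hz1.2
  · rw [Finset.card_insert_of_notMem (fun h => hyW (Finset.mem_sdiff.1 h).1),
      Finset.card_sdiff_of_subset hDW]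
    omega
  · omega
  · intro a ha
    rw [Finset.mem_insert] at ha
    rcases ha with rfl | ha
    · exact hfy
    · exact hfZ _ (hWprop _ (Finset.mem_sdiff.1 ha).1).1
  · intro a ha
    exact hgZ _ (hWprop _ (hDW ha)).1
  · intro a ha
    rw [Finset.mem_insert] at ha
    rcases ha with rfl | ha
    · simp only [List.mem_cons, List.mem_append, List.not_mem_nil, or_false, not_or]
      exact ⟨hfy.ne.symm, hpQZ _ hy _ hz0.1, hyl, hpQZ _ hy _ hz1.1, hyg⟩
    · exact (hWprop _ (Finset.mem_sdiff.1 ha).1).2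
  · exact fun a ha => (hWprop _ (hDW ha)).2
  · rw [Finset.disjoint_left]
    intro a ha ha'
    rw [Finset.mem_insert] at ha
    rcases ha with rfl | ha
    · exact hyW (hDW ha')
    · exact (Finset.mem_sdiff.1 ha).2 ha'

theorem isChain_range_of {R : ℕ → ℕ → Prop} (s len : ℕ)
    (h : ∀ k, s ≤ k → k + 1 < s + len → R k (k + 1)) : (List.range' s len).IsChain R := by
  induction len generalizing s with
  | zero => simp
  | succ m ih =>
    rw [List.range'_succ]
    cases m with
    | zero => simp
    | succ m =>
      have h1 := ih (s + 1) (fun k hk hk' => h k (by omega) (by omega))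
      rw [List.range'_succ] at h1 ⊢
      rw [List.isChain_cons_cons]
      exact ⟨h s le_rfl (by omega), h1⟩

open Classical in
theorem blue_idx {V : Type*} (H : SimpleGraph V) (p n : ℕ) (w : ℕ → V)
    (hinj : ∀ i j, i < 2 * p + 2 → j < 2 * p + 2 → w i = w j → i = j)
    (u : V) (hu : ∀ i < 2 * p + 2, w i ≠ u) (h0u : H.Adj (w 0) u)
    (A : Finset V) (hA : n ≤ A.card) (hAw : ∀ a ∈ A, H.Adj (w 0) a) (hAu : u ∉ A)
    (hAi : ∀ i < 2 * p + 2, w i ∉ A)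
    (idx : List ℕ) (a e d1 d2 : ℕ) (ha : idx.head? = some a) (he : idx.getLast? = some e)
    (hlen : idx.length + 1 = 2 * p) (hnd : idx.Nodup) (hr : ∀ i ∈ idx, 0 < i ∧ i < 2 * p + 2)
    (hch : idx.IsChain (fun i j => H.Adj (w i) (w j))) (hua : H.Adj u (w a))
    (hd1 : 0 < d1 ∧ d1 < 2 * p + 2) (hd2 : 0 < d2 ∧ d2 < 2 * p + 2) (hd12 : d1 ≠ d2)
    (hd1i : d1 ∉ idx) (hd2i : d2 ∉ idx) (he1 : H.Adj (w e) (w d1)) (he2 : H.Adj (w e) (w d2)) :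
    HasCopy (LinkedDoubleStar (2 * p + 1) n 2) H := by
  have hnot : ∀ d, d < 2 * p + 2 → d ∉ idx → w d ∉ idx.map w := by
    intro d hd hdi hm
    rw [List.mem_map] at hm
    obtain ⟨i, hi, hiw⟩ := hm
    have := hinj i d (hr i hi).2 hd hiw
    exact hdi (this ▸ hi)
  have h0 : w 0 ∉ idx.map w := hnot 0 (by omega) (fun h => by have := (hr 0 h).1; omega)
  have hum : u ∉ idx.map w := by
    intro hm
    rw [List.mem_map] at hm
    obtain ⟨i, hi, hiw⟩ := hm
    exact hu i (hr i hi).2 hiw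
  have hDl : ∀ d, 0 < d → d < 2 * p + 2 → d ∉ idx → w d ∉ w 0 :: u :: idx.map w := by
    intro d hd hd' hdi
    simp only [List.mem_cons, not_or]
    exact ⟨fun h => by have := hinj _ _ hd' (by omega) h; omega, hu d hd', hnot d hd' hdi⟩
  refine embed_lds H (2 * p + 1) n (w 0 :: u :: idx.map w) ?_ (w 0) (w e) rfl ?_ ?_ ?_ A
    {w d1, w d2} hA ?_ hAw ?_ ?_ ?_ ?_
  · simp; omega
  · simp [List.getLast?_cons, List.getLast?_map, he]
  · rw [List.nodup_cons, List.nodup_cons]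
    refine ⟨?_, hum, ?_⟩
    · rw [List.mem_cons, not_or]
      exact ⟨hu 0 (by omega), h0⟩
    · exact List.Nodup.map_on (fun i hi j hj h => hinj i j (hr i hi).2 (hr j hj).2 h) hnd
  · rw [List.isChain_cons_cons]
    refine ⟨h0u, ?_⟩
    rw [List.isChain_cons]
    refine ⟨?_, ?_⟩
    · intro y hy
      rw [List.head?_map, ha] at hy
      simp at hy
      exact hy ▸ hua
    · rw [List.isChain_map]
      exact hch
  · rw [Finset.card_pair]
    intro h
    exact hd12 (hinj _ _ hd1.2 hd2.2 h)
  · intro x hx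
    simp at hx
    rcases hx with rfl | rfl
    · exact he1
    · exact he2
  · intro x hx hxl
    simp only [List.mem_cons, List.mem_map] at hxl
    rcases hxl with rfl | rfl | ⟨i, hi, rfl⟩
    · exact hAi _ (by omega) hx
    · exact hAu hx
    · exact hAi i (hr i hi).2 hx
  · intro x hx
    simp at hx
    rcases hx with rfl | rfl
    · exact hDl _ hd1.1 hd1.2 hd1i
    · exact hDl _ hd2.1 hd2.2 hd2i
  · rw [Finset.disjoint_left]
    intro x hx hx'
    simp at hx'
    rcases hx' with rfl | rfl
    · exact hAi _ hd1.2 hx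
    · exact hAi _ hd2.2 hx

open Classical in
theorem blue_big {V : Type*} (H : SimpleGraph V) (p n : ℕ) (hp : 3 ≤ p) (w : ℕ → V)
    (hinj : ∀ i j, i < 2 * p + 2 → j < 2 * p + 2 → w i = w j → i = j)
    (hcyc : ∀ i, i < 2 * p + 1 → H.Adj (w i) (w (i + 1)))
    (u : V) (hu : ∀ i < 2 * p + 2, w i ≠ u) (h0u : H.Adj (w 0) u)
    (A : Finset V) (hA : n ≤ A.card) (hAw : ∀ a ∈ A, H.Adj (w 0) a) (hAu : u ∉ A)
    (hAi : ∀ i < 2 * p + 2, w i ∉ A)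
    (h2 : ∀ j < 2 * p + 2, j ≠ 2 → j ≠ 2 * p → H.Adj (w 2) (w j))
    (h2p : ∀ j < 2 * p + 2, j ≠ 2 → j ≠ 2 * p → H.Adj (w (2 * p)) (w j))
    (i : ℕ) (hi0 : i ≠ 0) (hi : i < 2 * p + 2) (hi2 : i ≠ 2) (hi2p : i ≠ 2 * p)
    (hui : H.Adj u (w i)) :
    HasCopy (LinkedDoubleStar (2 * p + 1) n 2) H := by
  have key := blue_idx H p n w hinj u hu h0u A hA hAw hAu hAi
  have hcase : (i = 1 ∨ i = 2 * p + 1) ∨ i = 3 ∨ (4 ≤ i ∧ i ≤ 2 * p - 1) := by omega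
  rcases hcase with h1 | h3 | h4
  · refine key ([i, 2 * p] ++ List.range' 3 (2 * p - 4) ++ [2]) i 2 (2 * p - 1)
      (if i = 1 then 2 * p + 1 else 1) (by simp) (by rw [List.getLast?_append]; simp) ?_ ?_ ?_ ?_ hui ?_ ?_ ?_ ?_ ?_ ?_ ?_
    · simp; omega
    · rw [List.nodup_append, List.nodup_append]
      refine ⟨⟨?_, List.nodup_range', ?_⟩, by simp, ?_⟩
      · simp; omega
      · intro a ha b hb
        simp at ha hb
        omega
      · intro a ha b hb
        simp at ha hb
        omega
    · intro j hj
      simp at hj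
      omega
    · rw [List.isChain_append, List.isChain_append]
      refine ⟨⟨?_, ?_, ?_⟩, by simp, ?_⟩
      · simp
        exact (h2p i hi hi2 hi2p).symm
      · exact isChain_range_of _ _ (fun k hk hk' => hcyc k (by omega))
      · simp [List.head?_range']
        intro _
        exact h2p 3 (by omega) (by omega) (by omega)
      · rw [List.getLast?_append, List.getLast?_range', if_neg (by omega)]
        simp
        exact (h2 _ (by omega) (by omega) (by omega)).symm
    · omega
    · split <;> omega
    · split <;> omega
    · simp; omega
    · split
      · simp; omega
      · simp; omega
    · exact h2 _ (by omega) (by omega) (by omega)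
    · split
      · exact h2 _ (by omega) (by omega) (by omega)
      · exact h2 _ (by omega) (by omega) (by omega)
  · subst h3
    refine key ([3, 2] ++ List.range' 4 (2 * p - 3)) 3 (2 * p) 1 (2 * p + 1)
      (by simp) ?_ ?_ ?_ ?_ ?_ hui ?_ ?_ ?_ ?_ ?_ ?_ ?_
    · rw [List.getLast?_append, List.getLast?_range', if_neg (by omega)]
      simp; omega
    · simp; omega
    · rw [List.nodup_append]
      refine ⟨by simp, List.nodup_range', ?_⟩
      intro a ha b hb
      simp at ha hb
      omega
    · intro j hj
      simp at hj
      omega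
    · rw [List.isChain_append]
      refine ⟨?_, ?_, ?_⟩
      · simp
        exact (h2 3 (by omega) (by omega) (by omega)).symm
      · exact isChain_range_of _ _ (fun k hk hk' => hcyc k (by omega))
      · simp [List.head?_range']
        intro _
        exact h2 4 (by omega) (by omega) (by omega)
    · omega
    · omega
    · omega
    · simp
    · simp; omega
    · exact h2p _ (by omega) (by omega) (by omega)
    · exact h2p _ (by omega) (by omega) (by omega)
  · refine key (List.range' i (2 * p + 1 - i) ++ List.range' 3 (i - 3) ++ [2]) i 2 1 (2 * p + 1)
      ?_ (by simp) ?_ ?_ ?_ ?_ hui ?_ ?_ ?_ ?_ ?_ ?_ ?_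
    · simp [List.head?_append, List.head?_range']
      rw [if_neg (by omega)]
      simp
    · simp; omega
    · rw [List.nodup_append, List.nodup_append]
      refine ⟨⟨?_, List.nodup_range', ?_⟩, by simp, ?_⟩
      · exact List.nodup_range'
      · intro a ha b hb
        simp at ha hb
        omega
      · intro a ha b hb
        simp at ha hb
        omega
    · intro j hj
      simp at hj
      omega
    · rw [List.isChain_append, List.isChain_append]
      refine ⟨⟨?_, ?_, ?_⟩, by simp, ?_⟩
      · exact isChain_range_of _ _ (fun k hk hk' => hcyc k (by omega))
      · exact isChain_range_of _ _ (fun k hk hk' => hcyc k (by omega))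
      · rw [List.getLast?_range', if_neg (by omega), List.head?_range', if_neg (by omega)]
        simp
        have : i + (2 * p + 1 - i) - 1 = 2 * p := by omega
        rw [this]
        exact h2p 3 (by omega) (by omega) (by omega)
      · rw [List.getLast?_append, List.getLast?_range', if_neg (by omega)]
        simp
        exact (h2 _ (by omega) (by omega) (by omega)).symm
    · omega
    · omega
    · omega
    · simp; omega
    · simp; omega
    · exact h2 _ (by omega) (by omega) (by omega)
    · exact h2 _ (by omega) (by omega) (by omega)

open Classical in
theorem blue_far {V : Type*} (H : SimpleGraph V) (p n : ℕ) (w : ℕ → V)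
    (hinj : ∀ i j, i < 2 * p + 2 → j < 2 * p + 2 → w i = w j → i = j)
    (hcyc : ∀ i, i < 2 * p + 1 → H.Adj (w i) (w (i + 1)))
    (A : Finset V) (hA : n + 1 ≤ A.card) (hAw : ∀ a ∈ A, H.Adj (w 0) a)
    (hAi : ∀ i < 2 * p + 2, w i ∉ A)
    (z : V) (hz : ∀ i < 2 * p + 2, w i ≠ z) (hzw : H.Adj (w (2 * p)) z) :
    HasCopy (LinkedDoubleStar (2 * p + 1) n 2) H := by
  refine embed_lds H (2 * p + 1) n ((List.range' 0 (2 * p + 1)).map w) (by simp) (w 0) (w (2 * p))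
    ?_ ?_ ?_ ?_ (A.erase z) {w (2 * p + 1), z} ?_ ?_ ?_ ?_ ?_ ?_ ?_
  · rw [List.head?_map, List.head?_range', if_neg (by omega)]
    rfl
  · rw [List.getLast?_map, List.getLast?_range', if_neg (by omega)]
    simp
  · refine List.Nodup.map_on (fun i hi j hj h => ?_) List.nodup_range'
    simp at hi hj
    exact hinj i j (by omega) (by omega) h
  · rw [List.isChain_map]
    exact isChain_range_of _ _ (fun k _ hk => hcyc k (by omega))
  · have := Finset.pred_card_le_card_erase (s := A) (a := z)
    omega
  · rw [Finset.card_pair (hz _ (by omega))]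
  · intro a ha
    exact hAw a (Finset.mem_of_mem_erase ha)
  · intro a ha
    simp at ha
    rcases ha with rfl | rfl
    · exact hcyc _ (by omega)
    · exact hzw
  · intro a ha hal
    simp only [List.mem_map] at hal
    obtain ⟨i, hi, rfl⟩ := hal
    simp at hi
    exact hAi i (by omega) (Finset.mem_of_mem_erase ha)
  · intro a ha hal
    simp only [List.mem_map] at hal
    obtain ⟨i, hi, rfl⟩ := hal
    simp at hi ha
    rcases ha with h | h
    · have := hinj _ _ (by omega) (by omega) h
      omega
    · exact hz i (by omega) h
  · rw [Finset.disjoint_left]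
    intro a ha ha'
    simp at ha ha'
    rcases ha' with h | h
    · exact hAi (2 * p + 1) (by omega) (h ▸ ha.2)
    · exact ha.1 h

open Classical in
theorem blue_five {V : Type*} (H : SimpleGraph V) (Z : Finset V) (v a b c d e u z : V)
    (hnd : [v, a, b, c, d, e].Nodup) (hZ : ∀ x ∈ [v, a, b, c, d, e], x ∉ Z)
    (hu : u ∈ Z) (hz : z ∈ Z) (hzu : z ≠ u)
    (hb : 3 ≤ (Z.filter (fun x => H.Adj v x)).card)
    (h1 : H.Adj v u) (h2 : H.Adj u a) (h3 : H.Adj a b) (h4 : H.Adj b c) (h5 : H.Adj c d)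
    (h6 : H.Adj c z) (h7 : H.Adj v e) :
    HasCopy (LinkedDoubleStar 5 2 2) H := by
  obtain ⟨t, ht, ht'⟩ := exists_mem_of_card_lt (Z.filter (fun x => H.Adj v x)) {u, z}
    (lt_of_le_of_lt Finset.card_le_two (by omega))
  simp only [Finset.mem_filter, Finset.mem_insert, Finset.mem_singleton, not_or] at ht ht'
  have hne : ∀ x ∈ [v, a, b, c, d, e], ∀ y ∈ Z, x ≠ y := fun x hx y hy h => hZ x hx (h ▸ hy)
  simp only [List.nodup_cons, List.mem_cons, List.not_mem_nil, or_false, not_or] at hnd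
  simp only [List.mem_cons, List.not_mem_nil, or_false, forall_eq_or_imp, forall_eq] at hne
  obtain ⟨n1, n2, n3, n4, n5, n6⟩ := hne
  have n1u := n1 u hu
  have n2u := n2 u hu
  have n3u := n3 u hu
  have n4u := n4 u hu
  have n5u := n5 u hu
  have n6u := n6 u hu
  have n1z := n1 z hz
  have n2z := n2 z hz
  have n3z := n3 z hz
  have n4z := n4 z hz
  have n5z := n5 z hz
  have n6z := n6 z hz
  have n1t := n1 t ht.1
  have n2t := n2 t ht.1
  have n3t := n3 t ht.1
  have n4t := n4 t ht.1
  have n5t := n5 t ht.1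
  have n6t := n6 t ht.1
  clear n1 n2 n3 n4 n5 n6 hZ
  refine embed_lds H 5 2 [v, u, a, b, c] rfl v c rfl rfl ?_ ?_ {e, t} {d, z} ?_ ?_ ?_ ?_ ?_ ?_ ?_
  · simp; grind
  · simp; exact ⟨h1, h2, h3, h4⟩
  · rw [Finset.card_pair n6t]
  · rw [Finset.card_pair n5z]
  · simp; exact ⟨h7, ht.2⟩
  · simp; exact ⟨h5, h6⟩
  · simp; grind
  · simp; grind
  · simp; grind

theorem exists_enum {V : Type*} (F : Finset V) (m : ℕ) (hm : 0 < m) (h : m ≤ F.card) :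
    ∃ g : ℕ → V, (∀ k < m, g k ∈ F) ∧ ∀ i j, i < m → j < m → g i = g j → i = j := by
  obtain ⟨e⟩ : Nonempty (Fin m ↪ F) := Function.Embedding.nonempty_of_card_le (by simpa using h)
  refine ⟨fun k => if h : k < m then (e ⟨k, h⟩).1 else (e ⟨0, hm⟩).1, ?_, ?_⟩
  · intro k hk
    simp [hk]
  · intro i j hi hj hij
    simp only [hi, hj, dif_pos] at hij
    have := e.injective (Subtype.ext hij)
    simpa using this

theorem le_cycStat {V : Type*} [Fintype V] (H : SimpleGraph V) (C : Set V) (z : V) (hz : z ∉ C) :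
    ({w ∈ C | H.Adj z w}).ncard ≤ cycStat H C := by
  unfold cycStat
  refine le_csSup ?_ ⟨z, hz, rfl⟩
  exact (Set.toFinite _).bddAbove

theorem cycStat_attained {V : Type*} [Fintype V] (H : SimpleGraph V) (C : Set V) (z : V)
    (hz : z ∉ C) : ∃ u, u ∉ C ∧ ({w ∈ C | H.Adj u w}).ncard = cycStat H C := by
  have := Nat.sSup_mem (s := ((fun z => ({w ∈ C | H.Adj z w}).ncard) '' Cᶜ)) ⟨_, z, hz, rfl⟩
    (Set.toFinite _).bddAbove
  obtain ⟨u, hu, h⟩ := this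
  exact ⟨u, hu, h⟩

theorem alt_cycle {V : Type*} [Fintype V] (G : SimpleGraph V) (p : ℕ) (F Z : Finset V)
    (hd : Disjoint F Z) (hF : p + 1 ≤ F.card) (hZ : p + 2 ≤ Z.card)
    (hFZ : ∀ f ∈ F, ∀ z ∈ Z, G.Adj f z) :
    ∃ f : ZMod (2 * p + 2) → V, IsCycleMap G f ∧ p + 1 ≤ cycStat G (Set.range f) := by
  obtain ⟨gF, hF1, hF2⟩ := exists_enum F (p + 1) (by omega) hF
  obtain ⟨gZ, hZ1, hZ2⟩ := exists_enum Z (p + 2) (by omega) hZ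
  have hne : ∀ i j, i < p + 1 → j < p + 2 → gF i ≠ gZ j := fun i j hi hj h =>
    Finset.disjoint_left.1 hd (hF1 i hi) (h ▸ hZ1 j hj)
  haveI : NeZero (2 * p + 2) := ⟨by omega⟩
  let f : ZMod (2 * p + 2) → V := fun i => if i.val % 2 = 0 then gF (i.val / 2) else gZ (i.val / 2)
  refine ⟨f, ⟨?_, ?_⟩, ?_⟩
  · intro i j hij
    have hi := ZMod.val_lt i
    have hj := ZMod.val_lt j
    apply ZMod.val_injective
    simp only [f] at hij
    split_ifs at hij with h1 h2 h2
    · have := hF2 _ _ (by omega) (by omega) hij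
      omega
    · exact absurd hij (hne _ _ (by omega) (by omega))
    · exact absurd hij.symm (hne _ _ (by omega) (by omega))
    · have := hZ2 _ _ (by omega) (by omega) hij
      omega
  · intro i
    have hi := ZMod.val_lt i
    have hv : (i + 1).val = if i.val + 1 = 2 * p + 2 then 0 else i.val + 1 := by
      have h1 : (1 : ZMod (2 * p + 2)).val = 1 := by
        have : ((1 : ℕ) : ZMod (2 * p + 2)).val = 1 % (2 * p + 2) := ZMod.val_natCast _ _
        rw [Nat.cast_one] at this
        rw [this, Nat.mod_eq_of_lt (by omega)]
      rw [ZMod.val_add, h1]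
      split_ifs with h
      · rw [h]; simp
      · exact Nat.mod_eq_of_lt (by omega)
    simp only [f, hv]
    split_ifs
    all_goals first
      | omega
      | (apply hFZ _ (hF1 _ (by omega)) _ (hZ1 _ (by omega)))
      | (apply (hFZ _ (hF1 _ (by omega)) _ (hZ1 _ (by omega))).symm)
  · have hz : gZ (p + 1) ∉ Set.range f := by
      rintro ⟨i, hi⟩
      have hi' := ZMod.val_lt i
      simp only [f] at hi
      split_ifs at hi with h
      · exact hne _ _ (by omega) (by omega) hi
      · have := hZ2 _ _ (by omega) (by omega) hi
        omega
    refine le_trans ?_ (le_cycStat G _ _ hz)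
    classical
    have hc : ((Finset.range (p + 1)).image gF).card = p + 1 := by
      rw [Finset.card_image_of_injOn, Finset.card_range]
      intro i hi j hj h
      simp at hi hj
      exact hF2 i j (by omega) (by omega) h
    refine hc.symm.le.trans ?_
    rw [← Set.ncard_coe_finset]
    refine Set.ncard_le_ncard ?_ (Set.toFinite _)
    intro x hx
    simp only [Finset.coe_image, Set.mem_image, Finset.coe_range, Set.mem_Iio] at hx
    obtain ⟨k, hk, rfl⟩ := hx
    refine ⟨⟨((2 * k : ℕ) : ZMod (2 * p + 2)), ?_⟩, ?_⟩
    · have : ((2 * k : ℕ) : ZMod (2 * p + 2)).val = 2 * k := by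
        rw [ZMod.val_natCast, Nat.mod_eq_of_lt (by omega)]
      simp only [f, this]
      rw [if_pos (by omega)]
      congr 1
      omega
    · exact (hFZ _ (hF1 k hk) _ (hZ1 _ (by omega))).symm

/-- on `n + 3p + 3` vertices, if `Q` is a blue cycle on `2p+2`
vertices with `s(Q)` maximal among all monochromatic cycles on `2p+2` vertices
and `s(Q) = p`, then there is a monochromatic `S_c(n,2)`
(red edges form `G`, blue edges form `Gᶜ`). -/
theorem lds_sQ_eq_p (p n : ℕ) (hp : 1 ≤ p) (hn2 : 2 ≤ n) (hnp : n ≤ p)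
    {V : Type*} [Fintype V] (hV : Fintype.card V = n + 3 * p + 3)
    (G : SimpleGraph V) (q : ZMod (2 * p + 2) → V) (hq : IsCycleMap Gᶜ q)
    (hmaxR : ∀ f : ZMod (2 * p + 2) → V, IsCycleMap G f →
      cycStat G (Set.range f) ≤ cycStat Gᶜ (Set.range q))
    (hmaxB : ∀ f : ZMod (2 * p + 2) → V, IsCycleMap Gᶜ f →
      cycStat Gᶜ (Set.range f) ≤ cycStat Gᶜ (Set.range q))
    (hs : cycStat Gᶜ (Set.range q) = p) :
    HasMonoLDS G (2 * p + 1) n 2 := by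
  classical
  have hp2 : 2 ≤ p := by omega
  haveI : NeZero (2 * p + 2) := ⟨by omega⟩
  by_contra hno
  unfold HasMonoLDS at hno
  rw [not_or] at hno
  obtain ⟨hnoR, hnoB⟩ := hno
  obtain ⟨hqinj, hqadj⟩ := hq
  obtain ⟨Q, hQdef⟩ : ∃ Q : Finset V, Q = Finset.univ.image q := ⟨_, rfl⟩
  obtain ⟨Z, hZdef⟩ : ∃ Z : Finset V, Z = Finset.univ \ Q := ⟨_, rfl⟩
  have hqQ : ∀ i, q i ∈ Q := fun i => by rw [hQdef]; exact Finset.mem_image_of_mem _ (Finset.mem_univ _)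
  have hQq : ∀ x ∈ Q, ∃ i, q i = x := fun x hx => by
    rw [hQdef] at hx
    simpa using hx
  have hQr : Set.range q = ↑Q := by rw [hQdef]; simp
  have hQc : Q.card = 2 * p + 2 := by
    rw [hQdef, Finset.card_image_of_injective _ hqinj, Finset.card_univ, ZMod.card]
  have hZc : Z.card = n + p + 1 := by
    rw [hZdef, Finset.card_sdiff_of_subset (Finset.subset_univ _), Finset.card_univ, hV, hQc]
    omega
  have hZm : ∀ z, z ∈ Z ↔ z ∉ Q := fun z => by rw [hZdef]; simp
  have hd : Disjoint Q Z := by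
    rw [Finset.disjoint_left]
    intro x hx hxz
    exact (hZm x).1 hxz hx
  have hne : ∀ x ∈ Q, ∀ z ∈ Z, x ≠ z := fun x hx z hz h => (hZm z).1 hz (h ▸ hx)
  have hstat : ∀ z ∈ Z, ({w ∈ Set.range q | Gᶜ.Adj z w}).ncard
      = (Q.filter (fun x => ¬ G.Adj z x)).card := by
    intro z hz
    rw [← Set.ncard_coe_finset]
    congr 1
    ext x
    simp only [Set.mem_ofPred_eq, hQr, Finset.coe_filter, Finset.mem_coe, SimpleGraph.compl_adj]
    constructor
    · rintro ⟨h1, h2⟩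
      exact ⟨h1, h2.2⟩
    · rintro ⟨h1, h2⟩
      exact ⟨h1, (hne x h1 z hz).symm, h2⟩
  have hzr : ∀ z ∈ Z, z ∉ Set.range q := fun z hz => by
    rw [hQr]
    exact (hZm z).1 hz
  have hzle : ∀ z ∈ Z, (Q.filter (fun x => ¬ G.Adj z x)).card ≤ p := by
    intro z hz
    rw [← hstat z hz]
    exact (le_cycStat _ _ _ (hzr z hz)).trans hs.le
  obtain ⟨z0, hz0⟩ : Z.Nonempty := Finset.card_pos.1 (by omega)
  obtain ⟨u, hu, hus⟩ := cycStat_attained Gᶜ (Set.range q) z0 (hzr z0 hz0)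
  have huZ : u ∈ Z := by
    rw [hZm]
    rw [hQr] at hu
    exact hu
  rw [hs, hstat u huZ] at hus
  have hbl : ∀ x ∈ Q, ∀ z ∈ Z, (Gᶜ.Adj x z ↔ ¬ G.Adj x z) := by
    intro x hx z hz
    rw [SimpleGraph.compl_adj]
    exact ⟨fun h => h.2, fun h => ⟨hne x hx z hz, h⟩⟩
  have hb : ∀ x ∈ Q, (Z.filter (fun z => G.Adj x z)).card
      + (Z.filter (fun z => Gᶜ.Adj x z)).card = n + p + 1 := by
    intro x hx
    rw [← hZc, ← Finset.card_filter_add_card_filter_not (s := Z) (fun z => G.Adj x z)]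
    congr 2
    exact Finset.filter_congr (fun z hz => hbl x hx z hz)
  -- the two shifts of the cycle
  have hcast : ∀ i j : ℕ, i < 2 * p + 2 → j < 2 * p + 2 →
      (i : ZMod (2 * p + 2)) = (j : ZMod (2 * p + 2)) → i = j := by
    intro i j hi hj h
    rw [ZMod.natCast_eq_natCast_iff', Nat.mod_eq_of_lt hi, Nat.mod_eq_of_lt hj] at h
    exact h
  have h2p0 : ((2 * p : ℕ) : ZMod (2 * p + 2)) = -2 := by
    have h := ZMod.natCast_self (2 * p + 2)
    rw [Nat.cast_add] at h
    exact eq_neg_of_add_eq_zero_left (by simpa using h)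
  have hfar : ∀ i, n + 1 ≤ (Z.filter (fun z => Gᶜ.Adj (q i) z)).card →
      ∀ z ∈ Z, G.Adj (q (i + 2)) z ∧ G.Adj (q (i - 2)) z := by
    intro i hi z hz
    constructor
    · by_contra hc
      apply hnoB
      refine blue_far Gᶜ p n (fun j => q (i - (j : ℕ))) ?_ ?_ _ hi ?_ ?_ z ?_ ?_
      · intro a b ha hb h
        exact hcast a b ha hb (sub_right_injective (hqinj h))
      · intro a _
        have := (hqadj (i - ((a + 1 : ℕ) : ZMod (2 * p + 2)))).symm
        have he : i - ((a + 1 : ℕ) : ZMod (2 * p + 2)) + 1 = i - (a : ℕ) := by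
          push_cast
          ring
        rw [he] at this
        exact this
      · intro a ha
        simpa using (Finset.mem_filter.1 ha).2
      · intro j _ hj
        exact hne _ (hqQ _) _ (Finset.mem_filter.1 hj).1 rfl
      · intro j _
        exact hne _ (hqQ _) _ hz
      · show Gᶜ.Adj (q (i - ((2 * p : ℕ) : ZMod (2 * p + 2)))) z
        rw [h2p0, sub_neg_eq_add]
        exact (hbl _ (hqQ _) _ hz).2 hc
    · by_contra hc
      apply hnoB
      refine blue_far Gᶜ p n (fun j => q (i + (j : ℕ))) ?_ ?_ _ hi ?_ ?_ z ?_ ?_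
      · intro a b ha hb h
        exact hcast a b ha hb (add_right_injective _ (hqinj h))
      · intro a _
        have := hqadj (i + (a : ℕ))
        rw [add_assoc] at this
        show Gᶜ.Adj _ (q (i + ((a + 1 : ℕ) : ZMod (2 * p + 2))))
        rw [Nat.cast_add, Nat.cast_one]
        exact this
      · intro a ha
        simpa using (Finset.mem_filter.1 ha).2
      · intro j _ hj
        exact hne _ (hqQ _) _ (Finset.mem_filter.1 hj).1 rfl
      · intro j _
        exact hne _ (hqQ _) _ hz
      · show Gᶜ.Adj (q (i + ((2 * p : ℕ) : ZMod (2 * p + 2)))) z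
        rw [h2p0, ← sub_eq_add_neg]
        exact (hbl _ (hqQ _) _ hz).2 hc
  obtain ⟨F, hF⟩ : ∃ F : Finset V, F = Q.filter (fun x => ∀ z ∈ Z, G.Adj x z) := ⟨_, rfl⟩
  obtain ⟨T, hT⟩ : ∃ T : Finset V, T = Q.filter (fun x =>
      n + 1 ≤ (Z.filter (fun z => Gᶜ.Adj x z)).card) := ⟨_, rfl⟩
  have hFm : ∀ x, x ∈ F ↔ x ∈ Q ∧ ∀ z ∈ Z, G.Adj x z := fun x => by rw [hF]; simp
  have hFp : F.card ≤ p := by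
    by_contra hc
    obtain ⟨f, hf, hf'⟩ := alt_cycle G p F Z
      (Finset.disjoint_of_subset_left (by rw [hF]; exact Finset.filter_subset _ _) hd)
      (by omega) (by omega) (fun f hf => ((hFm f).1 hf).2)
    have := hmaxR f hf
    omega
  have hTp : T.card ≤ p := by
    refine le_trans ?_ hFp
    let I : Finset (ZMod (2 * p + 2)) := Finset.univ.filter (fun i => q i ∈ T)
    have h1 : T ⊆ I.image q := by
      intro x hx
      obtain ⟨i, rfl⟩ := hQq x (by rw [hT] at hx; exact (Finset.mem_filter.1 hx).1)
      exact Finset.mem_image_of_mem _ (by simp [I, hx])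
    have h2 : I.image (fun i => q (i + 2)) ⊆ F := by
      intro x hx
      obtain ⟨i, hi, rfl⟩ := Finset.mem_image.1 hx
      simp only [I, Finset.mem_filter, Finset.mem_univ, true_and, hT] at hi
      exact (hFm _).2 ⟨hqQ _, fun z hz => (hfar i hi.2 z hz).1⟩
    have h3 := Finset.card_le_card h1
    have h4 := Finset.card_le_card h2
    rw [Finset.card_image_of_injective _ (fun a b h => add_left_injective _ (hqinj h))] at h4
    exact h3.trans (Finset.card_image_le.trans h4)
  have hfull : ∀ f g y, f ∈ F → g ∈ F → y ∈ Q → f ≠ g → y ≠ g → ¬ G.Adj f y := by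
    intro f g y hf hg hy hfg hyg hfy
    have hc : p - 1 ≤ ((Q \ T) \ {f, g, y}).card := by
      have h1 := Finset.le_card_sdiff T Q
      have h2 := Finset.le_card_sdiff {f, g, y} (Q \ T)
      have h3 : ({f, g, y} : Finset V).card ≤ 3 := Finset.card_le_three
      omega
    obtain ⟨E, hE, hEc⟩ := Finset.exists_subset_card_eq hc
    have hE' : ∀ x ∈ E, x ∈ Q ∧ x ∉ T ∧ x ≠ f ∧ x ≠ g ∧ x ≠ y := by
      intro x hx
      have := hE hx
      simp only [Finset.mem_sdiff, Finset.mem_insert, Finset.mem_singleton, not_or] at this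
      tauto
    apply hnoR
    refine red_full G p n hp2 hnp hn2 Q Z hd hZc f g y ((hFm f).1 hf).1 ((hFm g).1 hg).1 hy hfg hyg
      hfy ((hFm f).1 hf).2 ((hFm g).1 hg).2 E (fun x hx => (hE' x hx).1) hEc
      (fun h => (hE' _ h).2.2.1 rfl) (fun h => (hE' _ h).2.2.2.1 rfl)
      (fun h => (hE' _ h).2.2.2.2 rfl) ?_
    intro s hs
    have h1 := hb s (hE' s hs).1
    have h2 := (hE' s hs).2.1
    rw [hT, Finset.mem_filter, not_and] at h2
    have h3 := h2 (hE' s hs).1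
    omega
  by_cases hall : ∀ s ∈ Q, ¬ G.Adj u s → p + 1 ≤ (Z.filter (fun z => G.Adj s z)).card
  · apply hnoR
    refine red_main G p n hp2 hnp Q Z hd hQc hZc ?_ u huZ hus hall
    intro z hz
    have h1 := hzle z hz
    have h2 := Finset.card_filter_add_card_filter_not (s := Q) (fun x => G.Adj z x)
    omega
  push Not at hall
  obtain ⟨s, hsQ, hus0, hsb⟩ := hall
  obtain ⟨i0, rfl⟩ := hQq s hsQ
  have hbs : n + 1 ≤ (Z.filter (fun z => Gᶜ.Adj (q i0) z)).card := by
    have := hb _ hsQ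
    omega
  obtain ⟨w, hw⟩ : ∃ w : ℕ → V, w = fun j : ℕ => q (i0 + (j : ZMod (2 * p + 2))) := ⟨_, rfl⟩
  have hw0 : w 0 = q i0 := by rw [hw]; simp
  have hwQ : ∀ i, w i ∈ Q := fun i => by rw [hw]; exact hqQ _
  have hwinj : ∀ i j, i < 2 * p + 2 → j < 2 * p + 2 → w i = w j → i = j := by
    intro a b ha hb h
    rw [hw] at h
    exact hcast a b ha hb (add_right_injective _ (hqinj h))
  have hwc : ∀ i, Gᶜ.Adj (w i) (w (i + 1)) := by
    intro a
    have := hqadj (i0 + (a : ℕ))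
    rw [add_assoc] at this
    rw [hw]
    show Gᶜ.Adj _ (q (i0 + ((a + 1 : ℕ) : ZMod (2 * p + 2))))
    rw [Nat.cast_add, Nat.cast_one]
    exact this
  have hwlast : w (2 * p + 1 + 1) = w 0 := by
    rw [hw]
    show q (i0 + ((2 * p + 2 : ℕ) : ZMod (2 * p + 2))) = q (i0 + ((0 : ℕ) : ZMod (2 * p + 2)))
    rw [ZMod.natCast_self, Nat.cast_zero]
  have hwF2 : w 2 ∈ F := by
    rw [hFm]
    refine ⟨hwQ 2, fun z hz => ?_⟩
    have := (hfar i0 hbs z hz).1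
    rw [hw]
    simpa using this
  have hwF2p : w (2 * p) ∈ F := by
    rw [hFm]
    refine ⟨hwQ _, fun z hz => ?_⟩
    have := (hfar i0 hbs z hz).2
    rw [hw]
    show G.Adj (q (i0 + ((2 * p : ℕ) : ZMod (2 * p + 2)))) z
    rw [h2p0, ← sub_eq_add_neg]
    exact this
  have hwne : w 2 ≠ w (2 * p) := fun h => by
    have := hwinj _ _ (by omega) (by omega) h
    omega
  have h2 : ∀ j < 2 * p + 2, j ≠ 2 → j ≠ 2 * p → Gᶜ.Adj (w 2) (w j) := by
    intro j hj hj2 hj2p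
    rw [SimpleGraph.compl_adj]
    refine ⟨fun h => hj2 (hwinj _ _ (by omega) hj h).symm, ?_⟩
    exact hfull _ _ _ hwF2 hwF2p (hwQ j) hwne (fun h => hj2p (hwinj _ _ hj (by omega) h))
  have h2p : ∀ j < 2 * p + 2, j ≠ 2 → j ≠ 2 * p → Gᶜ.Adj (w (2 * p)) (w j) := by
    intro j hj hj2 hj2p
    rw [SimpleGraph.compl_adj]
    refine ⟨fun h => hj2p (hwinj _ _ (by omega) hj h).symm, ?_⟩
    exact hfull _ _ _ hwF2p hwF2 (hwQ j) hwne.symm (fun h => hj2 (hwinj _ _ hj (by omega) h))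
  rw [← hw0] at hsQ hus0 hbs
  clear hsb
  have hwu : ∀ i, w i ≠ u := fun i => hne _ (hwQ i) _ huZ
  obtain ⟨x, hx, hx0⟩ := exists_mem_of_card_lt (Q.filter (fun x => ¬ G.Adj u x)) {w 0}
    (by rw [Finset.card_singleton]; omega)
  rw [Finset.mem_singleton] at hx0
  rw [Finset.mem_filter] at hx
  obtain ⟨i, hi, rfl⟩ : ∃ i, i < 2 * p + 2 ∧ w i = x := by
    obtain ⟨k, rfl⟩ := hQq x hx.1
    refine ⟨(k - i0).val, ZMod.val_lt _, ?_⟩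
    rw [hw]
    show q (i0 + (((k - i0).val : ℕ) : ZMod (2 * p + 2))) = q k
    rw [ZMod.natCast_zmod_val]
    congr 1
    ring
  have hi0 : i ≠ 0 := fun h => hx0 (by rw [h])
  have hi2 : i ≠ 2 := by
    rintro rfl
    exact hx.2 (((hFm _).1 hwF2).2 u huZ).symm
  have hi2p : i ≠ 2 * p := by
    rintro rfl
    exact hx.2 (((hFm _).1 hwF2p).2 u huZ).symm
  have h0u : Gᶜ.Adj (w 0) u := (hbl _ (hwQ 0) _ huZ).2 (fun h => hus0 h.symm)
  have hui : Gᶜ.Adj u (w i) := ((hbl _ (hwQ i) _ huZ).2 (fun h => hx.2 h.symm)).symm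
  rcases Nat.lt_or_ge 2 p with hp3 | hp3
  · apply hnoB
    refine blue_big Gᶜ p n hp3 w hwinj (fun i _ => hwc i) u (fun i _ => hwu i) h0u
      ((Z.filter (fun z => Gᶜ.Adj (w 0) z)).erase u) ?_ ?_ (Finset.notMem_erase _ _) ?_ h2 h2p
      i hi0 hi hi2 hi2p hui
    · have := Finset.pred_card_le_card_erase (s := Z.filter (fun z => Gᶜ.Adj (w 0) z)) (a := u)
      omega
    · intro a ha
      exact (Finset.mem_filter.1 (Finset.mem_of_mem_erase ha)).2
    · intro j _ hj
      exact hne _ (hwQ j) _ (Finset.mem_filter.1 (Finset.mem_of_mem_erase hj)).1 rfl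
  · obtain rfl : p = 2 := by omega
    obtain rfl : n = 2 := by omega
    -- every vertex other than `w 2`, `w 4` has a blue neighbour outside
    have hex : ∀ j < 6, j ≠ 0 → j ≠ 2 → j ≠ 4 → j ≠ i →
        ∃ z ∈ Z, z ≠ u ∧ Gᶜ.Adj (w j) z := by
      intro j hj hj0 hj2 hj4 hji
      have hjF : w j ∉ F := by
        intro hjF
        have hsub : ({w j, w 2, w 4} : Finset V) ⊆ F := by
          intro y hy
          simp only [Finset.mem_insert, Finset.mem_singleton] at hy
          rcases hy with rfl | rfl | rfl
          · exact hjF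
          · exact hwF2
          · exact hwF2p
        have h3 : ({w j, w 2, w 4} : Finset V).card = 3 := by
          rw [Finset.card_eq_three]
          exact ⟨_, _, _, fun h => hj2 (hwinj _ _ hj (by omega) h),
            fun h => hj4 (hwinj _ _ hj (by omega) h), hwne, rfl⟩
        have := Finset.card_le_card hsub
        omega
      have hju : G.Adj u (w j) := by
        by_contra hc
        have hsub : ({w 0, w i, w j} : Finset V) ⊆ Q.filter (fun x => ¬ G.Adj u x) := by
          intro y hy
          rw [Finset.mem_filter]
          simp only [Finset.mem_insert, Finset.mem_singleton] at hy
          rcases hy with rfl | rfl | rfl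
          · exact ⟨hsQ, hus0⟩
          · exact hx
          · exact ⟨hwQ j, hc⟩
        have h3 : ({w 0, w i, w j} : Finset V).card = 3 := by
          rw [Finset.card_eq_three]
          exact ⟨_, _, _, fun h => hi0 (hwinj _ _ (by omega) hi h).symm,
            fun h => hj0 (hwinj _ _ (by omega) hj h).symm,
            fun h => hji (hwinj _ _ hi hj h).symm, rfl⟩
        have := Finset.card_le_card hsub
        omega
      rw [hFm, not_and] at hjF
      have h4 := hjF (hwQ j)
      push Not at h4
      obtain ⟨z, hz, hzj⟩ := h4
      refine ⟨z, hz, ?_, (hbl _ (hwQ j) _ hz).2 hzj⟩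
      rintro rfl
      exact hzj hju.symm
    have hnd6 : ∀ l : List ℕ, l.Nodup → (∀ a ∈ l, a < 6) → (l.map w).Nodup := by
      intro l hl hl6
      exact List.Nodup.map_on (fun a ha b hb h => hwinj a b (hl6 a ha) (hl6 b hb) h) hl
    have hmZ : ∀ l : List ℕ, ∀ x ∈ l.map w, x ∉ Z := by
      intro l x hx hxZ
      obtain ⟨a, _, rfl⟩ := List.mem_map.1 hx
      exact hne _ (hwQ a) _ hxZ rfl
    have h50 : Gᶜ.Adj (w 0) (w 5) := by
      have := hwc 5
      rw [show w (5 + 1) = w 0 from hwlast] at this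
      exact this.symm
    have hi135 : i = 1 ∨ i = 3 ∨ i = 5 := by omega
    apply hnoB
    rcases hi135 with rfl | rfl | rfl
    · obtain ⟨z, hz, hzu, hz3⟩ := hex 3 (by omega) (by omega) (by omega) (by omega) (by omega)
      exact blue_five Gᶜ Z (w 0) (w 1) (w 2) (w 3) (w 4) (w 5) u z
        (hnd6 [0, 1, 2, 3, 4, 5] (by decide) (by decide)) (hmZ [0, 1, 2, 3, 4, 5])
        huZ hz hzu (by convert hbs) h0u hui (hwc 1) (hwc 2) (hwc 3) hz3 h50
    · obtain ⟨z, hz, hzu, hz1⟩ := hex 1 (by omega) (by omega) (by omega) (by omega) (by omega)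
      exact blue_five Gᶜ Z (w 0) (w 3) (w 2) (w 1) (w 4) (w 5) u z
        (hnd6 [0, 3, 2, 1, 4, 5] (by decide) (by decide)) (hmZ [0, 3, 2, 1, 4, 5])
        huZ hz hzu (by convert hbs) h0u hui (hwc 2).symm (hwc 1).symm
        (h2p 1 (by omega) (by omega) (by omega)).symm hz1 h50
    · obtain ⟨z, hz, hzu, hz3⟩ := hex 3 (by omega) (by omega) (by omega) (by omega) (by omega)
      exact blue_five Gᶜ Z (w 0) (w 5) (w 4) (w 3) (w 2) (w 1) u z
        (hnd6 [0, 5, 4, 3, 2, 1] (by decide) (by decide)) (hmZ [0, 5, 4, 3, 2, 1])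
        huZ hz hzu (by convert hbs) h0u hui (hwc 4).symm (hwc 3).symm (hwc 2).symm hz3 (hwc 0)
end
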